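/- arXiv:1504.07618 — 2 statements merged into one kernel-verified Lean document; each statement's English description precedes it below -/
import Mathlib

section
/- Let ℓ be an odd prime. The number of conjugacy classes of subgroups of GL₂(ℤ/ℓℤ) that are conjugate to a subgroup of C_ns⁺(ℓ) and have dihedral projective image equals τ(ℓ²−1) − τ(ℓ−1) + τ((ℓ²−1)/4) − τ((ℓ−1)/2). -/
open Matrix Pointwise

/-- `GL₂(ℤ/ℓℤ)`. -/
abbrev GL2 (ℓ : ℕ) := GL (Fin 2) (ZMod ℓ)

/-- The underlying matrix of an element of `GL₂(ℤ/ℓℤ)`. -/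
def mat {ℓ : ℕ} (g : GL2 ℓ) : Matrix (Fin 2) (Fin 2) (ZMod ℓ) := g

/-- Membership in the non-split Cartan group `C_ns(ℓ)`: matrices of the form
`[[x, εy],[y, x]]`. -/
def IsNSElt {ℓ : ℕ} (ε : ZMod ℓ) (g : GL2 ℓ) : Prop :=
  mat g 1 1 = mat g 0 0 ∧ mat g 0 1 = ε * mat g 1 0

/-- Membership in the nontrivial coset `[[1,0],[0,−1]]·C_ns(ℓ)` of `C_ns(ℓ)` in its
normalizer: matrices of the form `[[x, εy],[−y, −x]]`. -/
def IsNSCosetElt {ℓ : ℕ} (ε : ZMod ℓ) (g : GL2 ℓ) : Prop :=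
  mat g 1 1 = -mat g 0 0 ∧ mat g 0 1 = -(ε * mat g 1 0)

/-- Membership in `C_ns⁺(ℓ)`, the normalizer of `C_ns(ℓ)` in `GL₂(ℤ/ℓℤ)`, generated by
`C_ns(ℓ)` together with `[[1,0],[0,−1]]`; it is the union of `C_ns(ℓ)` and its coset. -/
def IsNSPlusElt {ℓ : ℕ} (ε : ZMod ℓ) (g : GL2 ℓ) : Prop :=
  IsNSElt ε g ∨ IsNSCosetElt ε g

/-- The image of a subgroup of `GL₂(ℤ/ℓℤ)` in `PGL₂(ℤ/ℓℤ)`, the quotient of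
`GL₂(ℤ/ℓℤ)` by its center `Z(ℓ)`. -/
def projImage {ℓ : ℕ} (G : Subgroup (GL2 ℓ)) :
    Subgroup ((GL2 ℓ) ⧸ Subgroup.center (GL2 ℓ)) :=
  G.map (QuotientGroup.mk' (Subgroup.center (GL2 ℓ)))

/-- A subgroup of `GL₂(ℤ/ℓℤ)` has dihedral projective image if its image in `PGL₂(ℤ/ℓℤ)`
is isomorphic to the dihedral group of order `2m` for some `m ≥ 2` (the Klein four-group,
`m = 2`, counts as dihedral). -/
def IsDihedralProj {ℓ : ℕ} (G : Subgroup (GL2 ℓ)) : Prop :=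
  ∃ m : ℕ, 2 ≤ m ∧ Nonempty (↥(projImage G) ≃* DihedralGroup m)

/-- `τ(n)`, the number of positive divisors of `n`. -/
def tauFun (n : ℕ) : ℕ := n.divisors.card

/-- The number of conjugacy classes of subgroups satisfying `P`, i.e. the number of orbits
of the conjugation action on `{H : Subgroup G // P H}`. -/
noncomputable def conjClassCount {G : Type*} [Group G] (P : Subgroup G → Prop) : ℕ :=
  Nat.card (Quotient (Setoid.comap (Subtype.val : {H : Subgroup G // P H} → Subgroup G)
    (MulAction.orbitRel (ConjAct G) (Subgroup G))))

/-- The number of conjugacy classes attached to an admissible exponent `e`. -/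
def classMult (p e : ℕ) : ℕ := if 2 ∣ e ∧ e ∣ 2 * (p * (p + 1)) then 2 else 1

theorem classMult_le_two (p e : ℕ) : classMult p e ≤ 2 := by
  unfold classMult; split_ifs <;> norm_num

theorem gcd_mul_gcd_eq (p e : ℕ) (hp : 0 < p) (he : e ∣ 4 * (p * (p + 1))) :
    e.gcd (2 * p) * e.gcd (2 * p + 2) = e * classMult p e := by
  have hc : Nat.Coprime p (p + 1) := by simp
  have hT : 0 < p * (p + 1) := by positivity
  rcases Nat.even_or_odd' e with ⟨f, rfl | rfl⟩
  · have hf : f ∣ 2 * (p * (p + 1)) := by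
      rw [show 4 * (p * (p + 1)) = 2 * (2 * (p * (p + 1))) by ring] at he
      exact Nat.dvd_of_mul_dvd_mul_left two_pos he
    have hprod : f.gcd p * f.gcd (p + 1) = f.gcd (p * (p + 1)) := (hc.gcd_mul f).symm
    rw [show 2 * p + 2 = 2 * (p + 1) by ring, Nat.gcd_mul_left, Nat.gcd_mul_left]
    have key : 2 * f.gcd (p * (p + 1)) = f * classMult p (2 * f) := by
      unfold classMult
      have hiff : (2 ∣ 2 * f ∧ 2 * f ∣ 2 * (p * (p + 1))) ↔ f ∣ p * (p + 1) := by
        simp [Nat.mul_dvd_mul_iff_left]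
      simp only [hiff]
      split_ifs with h
      · rw [Nat.gcd_eq_left h, mul_comm]
      · obtain ⟨c, hc'⟩ := Nat.gcd_dvd_left f (p * (p + 1))
        have h2 : f ∣ 2 * f.gcd (p * (p + 1)) := by
          rw [← Nat.gcd_mul_left]
          exact Nat.dvd_gcd (dvd_mul_left _ _) hf
        have hg : 0 < f.gcd (p * (p + 1)) := Nat.gcd_pos_of_pos_right _ hT
        have hc2 : c ∣ 2 := by
          generalize f.gcd (p * (p + 1)) = g at *
          subst hc'
          rw [mul_comm 2 g] at h2
          exact Nat.dvd_of_mul_dvd_mul_left hg h2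
        rcases (Nat.dvd_prime Nat.prime_two).1 hc2 with rfl | rfl
        · exact absurd (by rw [mul_one] at hc'; exact hc' ▸ Nat.gcd_dvd_right _ _) h
        · omega
    linear_combination 4 * hprod + 2 * key
  · have h2 : Nat.Coprime (2 * f + 1) 2 := by simp
    have h4 : Nat.Coprime (2 * f + 1) 4 := by
      simpa using Nat.Coprime.pow_right 2 h2
    rw [show 2 * p + 2 = 2 * (p + 1) by ring, Nat.Coprime.gcd_mul_left_cancel_right _ h2.symm,
      Nat.Coprime.gcd_mul_left_cancel_right _ h2.symm, ← hc.gcd_mul,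
      Nat.gcd_eq_left (h4.dvd_of_dvd_mul_left he), classMult, if_neg, mul_one]
    rintro ⟨h, -⟩
    omega

/-- The exponents `e` of the admissible subgroups `⟨ω ^ e⟩` of the Cartan subgroup. -/
def exponents (p : ℕ) : Finset ℕ := {e ∈ (4 * (p * (p + 1))).divisors | ¬ (2 * p + 2) ∣ e}

theorem card_filter_not_dvd (a b : ℕ) (hb : 0 < b) (ha : 0 < a) :
    (({e ∈ (a * b).divisors | ¬ b ∣ e} : Finset ℕ)).card =
      (a * b).divisors.card - a.divisors.card := by
  have h := Finset.card_filter_add_card_filter_not (s := (a * b).divisors) (fun e => b ∣ e)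
  have h2 : ({e ∈ (a * b).divisors | b ∣ e} : Finset ℕ).card = a.divisors.card := by
    symm
    apply Finset.card_bij (fun x _ => x * b)
    · intro x hx
      simp only [Nat.mem_divisors, Finset.mem_filter] at hx ⊢
      exact ⟨⟨Nat.mul_dvd_mul_right hx.1 b, by positivity⟩, dvd_mul_left _ _⟩
    · intro x _ y _ h
      exact Nat.eq_of_mul_eq_mul_right hb h
    · intro y hy
      simp only [Nat.mem_divisors, Finset.mem_filter] at hy
      obtain ⟨⟨h1, -⟩, c, rfl⟩ := hy
      refine ⟨c, ?_, mul_comm _ _⟩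
      rw [mul_comm b c] at h1
      exact Nat.mem_divisors.2 ⟨Nat.dvd_of_mul_dvd_mul_right hb h1, ha.ne'⟩
  omega

theorem sum_classMult (p : ℕ) (hp : 0 < p) :
    ∑ e ∈ exponents p, classMult p e =
      (4 * (p * (p + 1))).divisors.card - (2 * p).divisors.card + (p * (p + 1)).divisors.card -
        p.divisors.card := by
  have h1 : (exponents p).card =
      (4 * (p * (p + 1))).divisors.card - (2 * p).divisors.card := by
    have := card_filter_not_dvd (2 * p) (2 * p + 2) (by omega) (by omega)
    rwa [show 2 * p * (2 * p + 2) = 4 * (p * (p + 1)) by ring] at this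
  have h2 : ({e ∈ exponents p | 2 ∣ e ∧ e ∣ 2 * (p * (p + 1))} : Finset ℕ).card =
      (p * (p + 1)).divisors.card - p.divisors.card := by
    rw [← card_filter_not_dvd p (p + 1) (by omega) hp]
    symm
    apply Finset.card_bij (fun x _ => 2 * x)
    · intro x hx
      simp only [exponents, Nat.mem_divisors, Finset.mem_filter] at hx ⊢
      refine ⟨⟨⟨?_, by positivity⟩, ?_⟩, dvd_mul_right _ _, Nat.mul_dvd_mul_left 2 hx.1.1⟩
      · exact Nat.mul_dvd_mul (by norm_num) hx.1.1
      · rw [show 2 * p + 2 = 2 * (p + 1) by ring]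
        exact fun h => hx.2 (Nat.dvd_of_mul_dvd_mul_left two_pos h)
    · intro x _ y _ h
      exact Nat.eq_of_mul_eq_mul_left two_pos h
    · intro y hy
      simp only [exponents, Nat.mem_divisors, Finset.mem_filter] at hy ⊢
      obtain ⟨⟨-, h1⟩, ⟨c, rfl⟩, h2⟩ := hy
      refine ⟨c, ⟨⟨Nat.dvd_of_mul_dvd_mul_left two_pos h2, by positivity⟩, fun h => h1 ?_⟩, rfl⟩
      rw [show 2 * p + 2 = 2 * (p + 1) by ring]
      exact Nat.mul_dvd_mul_left 2 h
  have h3 : ∑ e ∈ exponents p, classMult p e = (exponents p).card +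
      ({e ∈ exponents p | 2 ∣ e ∧ e ∣ 2 * (p * (p + 1))} : Finset ℕ).card := by
    rw [Finset.card_filter, Finset.card_eq_sum_ones, ← Finset.sum_add_distrib]
    refine Finset.sum_congr rfl fun e _ => ?_
    unfold classMult
    split_ifs <;> rfl
  have h4 : p.divisors.card ≤ (p * (p + 1)).divisors.card :=
    Finset.card_le_card (Nat.divisors_subset_of_dvd (by positivity) (dvd_mul_right _ _))
  omega

theorem nonempty_mulEquiv_dihedralGroup {P : Type*} [Group P] {a b : P} (hb : b * b = 1)
    (hab : b * a = a⁻¹ * b) (hba : b ∉ Subgroup.zpowers a) (K : Subgroup P)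
    (hK : ∀ x, x ∈ K ↔ ∃ n : ℤ, x = a ^ n ∨ x = b * a ^ n) :
    Nonempty (K ≃* DihedralGroup (orderOf a)) := by
  set m := orderOf a
  have hz : ∀ x y : ℤ, a ^ x = a ^ y ↔ (x : ZMod m) = y := fun x y => by
    rw [zpow_eq_zpow_iff_modEq, ZMod.intCast_eq_intCast_iff]
  have hsemi : ∀ n : ℤ, b * a ^ n = a ^ (-n) * b := fun n => by
    have : SemiconjBy b a a⁻¹ := hab
    simpa [SemiconjBy] using this.zpow_right n
  let f : DihedralGroup m → P
    | .r j => a ^ (j.cast : ℤ)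
    | .sr j => b * a ^ (j.cast : ℤ)
  let F : DihedralGroup m →* P := MonoidHom.mk' f (by
    rintro (i | i) (j | j)
    · simp only [DihedralGroup.r_mul_r, f, ← _root_.zpow_add]
      rw [hz]; push_cast [ZMod.intCast_zmod_cast]; rfl
    · simp only [DihedralGroup.r_mul_sr, f]
      rw [← mul_assoc, show a ^ (i.cast : ℤ) * b = b * a ^ (-(i.cast : ℤ)) by
        rw [hsemi, neg_neg], mul_assoc, ← _root_.zpow_add, mul_right_inj, hz]
      push_cast [ZMod.intCast_zmod_cast]; ring
    · simp only [DihedralGroup.sr_mul_r, f]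
      rw [mul_assoc, ← _root_.zpow_add, mul_right_inj, hz]
      push_cast [ZMod.intCast_zmod_cast]; ring
    · simp only [DihedralGroup.sr_mul_sr, f]
      rw [hsemi, mul_assoc, ← mul_assoc b b, hb, one_mul, ← _root_.zpow_add, hz]
      push_cast [ZMod.intCast_zmod_cast]; ring)
  have hinj : Function.Injective F := by
    rw [injective_iff_map_eq_one]
    rintro (i | i) hi
    · have h1 : a ^ (i.cast : ℤ) = a ^ (0 : ℤ) := by simpa [F, f] using hi
      rw [hz] at h1
      rw [DihedralGroup.one_def]
      congr 1
      simpa using h1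
    · have h1 : b * a ^ (i.cast : ℤ) = 1 := hi
      refine absurd ⟨-(i.cast : ℤ), ?_⟩ hba
      simpa [_root_.zpow_neg] using (eq_inv_of_mul_eq_one_left h1).symm
  have hrange : F.range = K := by
    ext x
    rw [hK]
    constructor
    · rintro ⟨i | i, rfl⟩
      · exact ⟨_, Or.inl rfl⟩
      · exact ⟨_, Or.inr rfl⟩
    · rintro ⟨n, rfl | rfl⟩
      · refine ⟨.r n, ?_⟩
        change a ^ ((n : ZMod m).cast : ℤ) = a ^ n
        rw [hz]; simp
      · refine ⟨.sr n, ?_⟩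
        change b * a ^ ((n : ZMod m).cast : ℤ) = b * a ^ n
        rw [mul_right_inj, hz]; simp
  subst hrange
  exact ⟨(MonoidHom.ofInjective hinj).symm⟩

theorem isEmpty_mulEquiv_dihedralGroup_of_le_zpowers {P : Type*} [Group P] {a : P}
    {K : Subgroup P} (hK : K ≤ Subgroup.zpowers a) {m : ℕ} (hm : 2 ≤ m) :
    ¬ Nonempty (K ≃* DihedralGroup m) := by
  rintro ⟨φ⟩
  have : IsCyclic K := by
    have h : IsCyclic (Subgroup.zpowers a) := inferInstance
    exact isCyclic_of_injective (Subgroup.inclusion hK) (Subgroup.inclusion_injective hK)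
  exact DihedralGroup.not_isCyclic (by omega) (φ.isCyclic.1 this)

/-- The properties of a generator `ω` of a nonsplit Cartan subgroup of `GL₂` over a field with
`2 * p + 1` elements, of an involution `t` acting on it as the Frobenius, and of the
determinant `δ` that determine the subgroups of its normalizer up to conjugacy. -/
structure IsNonsplitPair {G A : Type*} [Group G] [Group A] (p : ℕ) (ω t : G) (δ : G →* A) :
    Prop where
  pos : 0 < p
  order : orderOf ω = 4 * (p * (p + 1))
  notMem : t ∉ Subgroup.zpowers ω
  mul_self : t * t = 1
  semiconj : SemiconjBy t ω (ω ^ (2 * p + 1))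
  mem_center : ∀ n : ℤ, ω ^ n ∈ Subgroup.center G ↔ (2 * p + 2 : ℤ) ∣ n
  order_map : orderOf (δ ω) = 2 * p
  map_t : δ t = δ ω ^ p

namespace IsNonsplitPair

variable {G A : Type*} [Group G] [Group A] {p : ℕ} {ω t : G} {δ : G →* A}

theorem mul_zpow_mul (h : IsNonsplitPair p ω t δ) (a b : ℤ) :
    ω ^ a * t * ω ^ b = ω ^ (a + (2 * p + 1) * b) * t := by
  have := (h.semiconj.zpow_right b).eq
  rw [mul_assoc, this, ← mul_assoc, _root_.zpow_add, ← zpow_natCast ω, ← _root_.zpow_mul]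
  push_cast
  rfl

theorem mul_zpow_mul_mul (h : IsNonsplitPair p ω t δ) (a b : ℤ) :
    ω ^ a * t * (ω ^ b * t) = ω ^ (a + (2 * p + 1) * b) := by
  rw [← mul_assoc, h.mul_zpow_mul, mul_assoc, h.mul_self, mul_one]

theorem inv_zpow_mul (h : IsNonsplitPair p ω t δ) (a : ℤ) :
    (ω ^ a * t)⁻¹ = ω ^ (-(2 * p + 1) * a) * t := by
  rw [inv_eq_iff_mul_eq_one, h.mul_zpow_mul_mul, ← orderOf_dvd_iff_zpow_eq_one, h.order]
  refine ⟨-a, ?_⟩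
  push_cast
  ring

theorem zpow_eq_zpow_iff (h : IsNonsplitPair p ω t δ) (a b : ℤ) :
    ω ^ a = ω ^ b ↔ (4 * (p * (p + 1)) : ℤ) ∣ b - a := by
  rw [zpow_eq_zpow_iff_modEq, h.order, Int.modEq_iff_dvd]
  push_cast
  rfl

theorem zpow_ne_zpow_mul (h : IsNonsplitPair p ω t δ) (a b : ℤ) : ω ^ a ≠ ω ^ b * t := by
  intro hab
  apply h.notMem
  rw [← inv_mul_eq_iff_eq_mul] at hab
  rw [← hab]
  exact mul_mem (inv_mem ⟨b, rfl⟩) ⟨a, rfl⟩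

/-- The subgroup generated by `ω ^ e` and `ω ^ i * t`. -/
def sub (h : IsNonsplitPair p ω t δ) (e i : ℤ) (hi : e ∣ i * (2 * p + 2)) : Subgroup G where
  carrier := {x | ∃ n : ℤ, (e ∣ n ∧ x = ω ^ n) ∨ (e ∣ n - i ∧ x = ω ^ n * t)}
  one_mem' := ⟨0, Or.inl ⟨dvd_zero _, (_root_.zpow_zero _).symm⟩⟩
  mul_mem' := by
    rintro x y ⟨n, ⟨hn, rfl⟩ | ⟨hn, rfl⟩⟩ ⟨k, ⟨hk, rfl⟩ | ⟨hk, rfl⟩⟩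
    · exact ⟨_, Or.inl ⟨dvd_add hn hk, (_root_.zpow_add _ _ _).symm⟩⟩
    · refine ⟨n + k, Or.inr ⟨?_, by rw [_root_.zpow_add, mul_assoc]⟩⟩
      rw [add_sub_assoc]
      exact dvd_add hn hk
    · refine ⟨_, Or.inr ⟨?_, h.mul_zpow_mul n k⟩⟩
      rw [add_sub_right_comm]
      exact dvd_add hn (hk.mul_left _)
    · refine ⟨_, Or.inl ⟨?_, h.mul_zpow_mul_mul n k⟩⟩
      rw [show n + (2 * p + 1) * k = (n - i) + (2 * p + 1) * (k - i) + i * (2 * p + 2) by ring]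
      exact dvd_add (dvd_add hn (hk.mul_left _)) hi
  inv_mem' := by
    rintro x ⟨n, ⟨hn, rfl⟩ | ⟨hn, rfl⟩⟩
    · exact ⟨-n, Or.inl ⟨hn.neg_right, (_root_.zpow_neg _ _).symm⟩⟩
    · refine ⟨_, Or.inr ⟨?_, h.inv_zpow_mul n⟩⟩
      rw [show -(2 * p + 1) * n - i = -((2 * p + 1) * (n - i)) - i * (2 * p + 2) by ring]
      exact dvd_sub (hn.mul_left _).neg_right hi

theorem mem_sub (h : IsNonsplitPair p ω t δ) {e i : ℤ} (hi : e ∣ i * (2 * p + 2)) {x : G} :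
    x ∈ h.sub e i hi ↔ ∃ n : ℤ, (e ∣ n ∧ x = ω ^ n) ∨ (e ∣ n - i ∧ x = ω ^ n * t) := Iff.rfl

/-- Subgroups whose coset exponents agree modulo `e` and `2 * p` are conjugate. -/
theorem exists_smul_sub_eq (h : IsNonsplitPair p ω t δ) {e i j : ℤ}
    (hi : e ∣ i * (2 * p + 2)) (hj : e ∣ j * (2 * p + 2))
    (hij : (Int.gcd e (2 * p) : ℤ) ∣ i - j) :
    ∃ g : ConjAct G, g • h.sub e j hj = h.sub e i hi := by
  obtain ⟨c, hc⟩ := hij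
  rw [Int.gcd_eq_gcd_ab] at hc
  set x := e.gcdA (2 * p)
  set y := e.gcdB (2 * p)
  refine ⟨ConjAct.toConjAct (ω ^ (-(y * c))), ?_⟩
  have conj₁ (k n : ℤ) : ω ^ k * ω ^ n * (ω ^ k)⁻¹ = ω ^ n := by
    rw [← _root_.zpow_add, ← _root_.zpow_neg, ← _root_.zpow_add]
    congr 1
    ring
  have conj₂ (k n : ℤ) : ω ^ k * (ω ^ n * t) * (ω ^ k)⁻¹ = ω ^ (n - 2 * p * k) * t := by
    rw [← mul_assoc, ← _root_.zpow_add, ← _root_.zpow_neg, h.mul_zpow_mul]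
    congr 2
    ring
  ext z
  rw [Subgroup.mem_smul_pointwise_iff_exists]
  constructor
  · rintro ⟨_, ⟨n, ⟨hn, rfl⟩ | ⟨hn, rfl⟩⟩, rfl⟩
    · rw [ConjAct.toConjAct_smul, conj₁]
      exact ⟨n, Or.inl ⟨hn, rfl⟩⟩
    · rw [ConjAct.toConjAct_smul, conj₂]
      refine ⟨_, Or.inr ⟨?_, rfl⟩⟩
      rw [show n - 2 * p * (-(y * c)) - i = (n - j) - e * (x * c) by linear_combination -hc]
      exact dvd_sub hn (dvd_mul_right _ _)
  · rintro ⟨n, ⟨hn, rfl⟩ | ⟨hn, rfl⟩⟩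
    · exact ⟨ω ^ n, ⟨n, Or.inl ⟨hn, rfl⟩⟩, by rw [ConjAct.toConjAct_smul, conj₁]⟩
    · refine ⟨ω ^ (n + 2 * p * (-(y * c))) * t, ⟨_, Or.inr ⟨?_, rfl⟩⟩, ?_⟩
      · rw [show n + 2 * p * (-(y * c)) - j = (n - i) + e * (x * c) by linear_combination hc]
        exact dvd_add hn (dvd_mul_right _ _)
      · rw [ConjAct.toConjAct_smul, conj₂, add_sub_cancel_right]

theorem card_sub (h : IsNonsplitPair p ω t δ) {e : ℕ} {i : ℤ} (he : e ∣ 4 * (p * (p + 1)))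
    (hi : (e : ℤ) ∣ i * (2 * p + 2)) :
    Nat.card (h.sub e i hi) = 2 * (4 * (p * (p + 1)) / e) := by
  have hfin : (Subgroup.zpowers (ω ^ e) : Set G).ncard = 4 * (p * (p + 1)) / e := by
    rw [← Nat.card_coe_set_eq]
    change Nat.card (Subgroup.zpowers (ω ^ e)) = _
    rw [Nat.card_zpowers, orderOf_pow_of_dvd _ (h.order ▸ he), h.order]
    rintro rfl
    have := h.pos
    have := zero_dvd_iff.1 he
    have : 0 < p * (p + 1) := by positivity
    omega
  have hM : 0 < 4 * (p * (p + 1)) := by have := h.pos; positivity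
  have hpos : 0 < 4 * (p * (p + 1)) / e := Nat.div_pos (Nat.le_of_dvd hM he)
    (Nat.pos_of_dvd_of_pos he hM)
  have hf : (Subgroup.zpowers (ω ^ e) : Set G).Finite :=
    Set.finite_of_ncard_pos (by omega)
  have hset : (h.sub e i hi : Set G) = (Subgroup.zpowers (ω ^ e) : Set G) ∪
      (· * (ω ^ i * t)) '' (Subgroup.zpowers (ω ^ e) : Set G) := by
    ext x
    simp only [SetLike.mem_coe, h.mem_sub, Set.mem_union, Set.mem_image, Subgroup.mem_zpowers_iff]
    constructor
    · rintro ⟨n, ⟨⟨k, rfl⟩, rfl⟩ | ⟨⟨k, hk⟩, rfl⟩⟩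
      · left
        exact ⟨k, by rw [← zpow_natCast ω, ← _root_.zpow_mul]⟩
      · right
        refine ⟨_, ⟨k, rfl⟩, ?_⟩
        rw [← zpow_natCast ω, ← _root_.zpow_mul, ← mul_assoc, ← _root_.zpow_add, ← hk, sub_add_cancel]
    · rintro (⟨k, rfl⟩ | ⟨_, ⟨k, rfl⟩, rfl⟩)
      · exact ⟨e * k, Or.inl ⟨dvd_mul_right _ _, by rw [← zpow_natCast ω, ← _root_.zpow_mul]⟩⟩
      · refine ⟨e * k + i, Or.inr ⟨by simp, ?_⟩⟩
        rw [← zpow_natCast ω, ← _root_.zpow_mul, ← mul_assoc, ← _root_.zpow_add]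
  change Nat.card (h.sub e i hi : Set G) = _
  rw [Nat.card_coe_set_eq, hset, Set.ncard_union_eq _ hf (hf.image _),
    Set.ncard_image_of_injective _ (mul_left_injective _), hfin, two_mul]
  rw [Set.disjoint_left]
  rintro _ ⟨a, rfl⟩ ⟨_, ⟨b, rfl⟩, hab⟩
  simp only [← zpow_natCast ω, ← _root_.zpow_mul, ← mul_assoc, ← _root_.zpow_add] at hab
  exact h.zpow_ne_zpow_mul _ _ hab.symm

theorem nonempty_map_sub_mulEquiv (h : IsNonsplitPair p ω t δ) {e : ℕ} {i : ℤ}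
    (hn : ¬ (2 * p + 2) ∣ e) (hi : (e : ℤ) ∣ i * (2 * p + 2)) :
    ∃ m : ℕ, 2 ≤ m ∧ Nonempty ((h.sub e i hi).map (QuotientGroup.mk' (Subgroup.center G)) ≃*
      DihedralGroup m) := by
  set π := QuotientGroup.mk' (Subgroup.center G)
  have hπ1 : ∀ x, π x = 1 ↔ x ∈ Subgroup.center G := fun x => QuotientGroup.eq_one_iff x
  have split (a b : ℤ) : π (ω ^ ((2 * p + 2) * a + b) * t) = π (ω ^ b * t) := by
    rw [_root_.zpow_add, mul_assoc, map_mul, (hπ1 _).2 ((h.mem_center _).2 (dvd_mul_right _ _)),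
      one_mul]
  refine ⟨orderOf (π (ω ^ e)), ?_, nonempty_mulEquiv_dihedralGroup (b := π (ω ^ i * t)) ?_ ?_ ?_ _ ?_⟩
  · have h1 : orderOf (π (ω ^ e)) ≠ 1 := by
      rw [Ne, orderOf_eq_one_iff, hπ1, ← zpow_natCast, h.mem_center]
      exact_mod_cast hn
    have h0 : orderOf (π (ω ^ e)) ≠ 0 := by
      rw [Ne, orderOf_eq_zero_iff, not_not]
      have : IsOfFinOrder ω := by
        rw [← orderOf_pos_iff, h.order]
        have := h.pos
        positivity
      exact π.isOfFinOrder this.pow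
    omega
  · rw [← map_mul, hπ1, h.mul_zpow_mul_mul, h.mem_center]
    exact ⟨i, by ring⟩
  · rw [← map_mul, ← zpow_natCast, h.mul_zpow_mul,
      show i + (2 * p + 1) * (e : ℤ) = (2 * p + 2) * e + (-e + i) by ring, split]
    rw [_root_.zpow_add, mul_assoc, map_mul, _root_.zpow_neg, map_inv]
  · rintro ⟨k, hk⟩
    simp only [← map_zpow] at hk
    rw [← inv_mul_eq_one, ← map_inv, ← map_mul, hπ1, ← zpow_natCast ω, ← _root_.zpow_mul,
      ← _root_.zpow_neg, ← mul_assoc, ← _root_.zpow_add] at hk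
    have hcomm := Subgroup.mem_center_iff.1 hk ω
    have h2 := h.mul_zpow_mul (-(e * k) + i) 1
    rw [_root_.zpow_one] at h2
    rw [h2, ← mul_assoc, mul_left_inj, ← _root_.zpow_one_add, h.zpow_eq_zpow_iff] at hcomm
    have hpos := h.pos
    rw [show -(e * k) + i + (2 * p + 1) * 1 - (1 + (-(e * k) + i)) = ((2 * p : ℕ) : ℤ) by
      push_cast; ring] at hcomm
    have h3 := Nat.le_of_dvd (by omega) (show 4 * (p * (p + 1)) ∣ 2 * p by exact_mod_cast hcomm)
    nlinarith
  · intro x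
    rw [Subgroup.mem_map]
    constructor
    · rintro ⟨_, ⟨n, ⟨⟨k, rfl⟩, rfl⟩ | ⟨hn, rfl⟩⟩, rfl⟩
      · exact ⟨k, Or.inl (by rw [← map_zpow, ← zpow_natCast, ← _root_.zpow_mul])⟩
      · obtain ⟨k, hk⟩ := hn
        refine ⟨-k, Or.inr ?_⟩
        rw [← map_zpow, ← map_mul, ← zpow_natCast ω, ← _root_.zpow_mul, h.mul_zpow_mul,
          show n = (2 * p + 2) * (e * k) + (i + (2 * p + 1) * (e * -k)) by linear_combination hk,
          split]
    · rintro ⟨n, rfl | rfl⟩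
      · exact ⟨_, ⟨e * n, Or.inl ⟨dvd_mul_right _ _, rfl⟩⟩,
          by rw [← map_zpow, ← zpow_natCast ω, ← _root_.zpow_mul]⟩
      · refine ⟨_, ⟨_, Or.inr ⟨?_, rfl⟩⟩, by
          rw [← map_zpow, ← map_mul, ← zpow_natCast ω, ← _root_.zpow_mul, h.mul_zpow_mul]⟩
        rw [show i + (2 * p + 1) * (e * n) - i = e * ((2 * p + 1) * n) by ring]
        exact dvd_mul_right _ _

theorem exists_eq_sub (h : IsNonsplitPair p ω t δ) {K : Subgroup G}
    (hK : ∀ x ∈ K, ∃ n : ℤ, x = ω ^ n ∨ x = ω ^ n * t) {m : ℕ} (hm : 2 ≤ m)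
    (hd : Nonempty (K.map (QuotientGroup.mk' (Subgroup.center G)) ≃* DihedralGroup m)) :
    ∃ e ∈ exponents p, ∃ (i : ℤ) (hi : (e : ℤ) ∣ i * (2 * p + 2)), K = h.sub e i hi := by
  set π := QuotientGroup.mk' (Subgroup.center G)
  have hπ1 : ∀ x, π x = 1 ↔ x ∈ Subgroup.center G := fun x => QuotientGroup.eq_one_iff x
  obtain ⟨i, hi⟩ : ∃ i : ℤ, ω ^ i * t ∈ K := by
    by_contra! hcon
    refine isEmpty_mulEquiv_dihedralGroup_of_le_zpowers (a := π ω) ?_ hm hd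
    rintro _ ⟨x, hx, rfl⟩
    obtain ⟨n, rfl | rfl⟩ := hK x hx
    · exact ⟨n, (map_zpow π ω n).symm⟩
    · exact absurd hx (hcon n)
  obtain ⟨e, he⟩ : ∃ e : ℕ, ∀ n : ℤ, ω ^ n ∈ K ↔ (e : ℤ) ∣ n := by
    let S : AddSubgroup ℤ := (K.comap (zpowersHom G ω)).toAddSubgroup'
    have hS : ∀ n : ℤ, n ∈ S ↔ ω ^ n ∈ K := fun n => Iff.rfl
    obtain ⟨a, ha⟩ := Int.subgroup_cyclic S
    refine ⟨a.natAbs, fun n => ?_⟩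
    rw [← hS, ha, ← AddSubgroup.zmultiples_eq_closure, Int.mem_zmultiples_iff, Int.natAbs_dvd]
  have heM : e ∣ 4 * (p * (p + 1)) := by
    have h1 : ω ^ ((4 * (p * (p + 1)) : ℕ) : ℤ) ∈ K := by
      rw [zpow_natCast, ← h.order, pow_orderOf_eq_one]
      exact one_mem K
    exact_mod_cast (he _).1 h1
  have hsub : (e : ℤ) ∣ i * (2 * p + 2) := by
    have h1 := mul_mem hi hi
    rw [h.mul_zpow_mul_mul, he] at h1
    rwa [show i * (2 * p + 2) = i + (2 * p + 1) * i by ring]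
  have hmem (n : ℤ) : ω ^ n * t ∈ K ↔ (e : ℤ) ∣ n - i := by
    have h1 : ω ^ n * t = ω ^ (n - i) * (ω ^ i * t) := by
      rw [← mul_assoc, ← _root_.zpow_add, sub_add_cancel]
    rw [h1, K.mul_mem_cancel_right hi, he]
  have heq : K = h.sub e i hsub := by
    ext x
    rw [h.mem_sub]
    constructor
    · intro hx
      obtain ⟨n, rfl | rfl⟩ := hK x hx
      · exact ⟨n, Or.inl ⟨(he n).1 hx, rfl⟩⟩
      · exact ⟨n, Or.inr ⟨(hmem n).1 hx, rfl⟩⟩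
    · rintro ⟨n, ⟨hn, rfl⟩ | ⟨hn, rfl⟩⟩
      · exact (he n).2 hn
      · exact (hmem n).2 hn
  refine ⟨e, ?_, i, hsub, heq⟩
  rw [exponents, Finset.mem_filter, Nat.mem_divisors]
  have hpos := h.pos
  refine ⟨⟨heM, by positivity⟩, fun hdvd => ?_⟩
  refine isEmpty_mulEquiv_dihedralGroup_of_le_zpowers (a := π (ω ^ i * t)) ?_ hm hd
  have hz : ∀ n : ℤ, (e : ℤ) ∣ n → π (ω ^ n) = 1 := fun n hn => by
    rw [hπ1, h.mem_center]
    exact dvd_trans (by exact_mod_cast hdvd) hn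
  rintro _ ⟨x, hx, rfl⟩
  obtain ⟨n, rfl | rfl⟩ := hK x hx
  · rw [hz n ((he n).1 hx)]
    exact one_mem _
  · refine ⟨1, ?_⟩
    have h1 : ω ^ n * t = ω ^ (n - i) * (ω ^ i * t) := by
      rw [← mul_assoc, ← _root_.zpow_add, sub_add_cancel]
    simp only [h1, map_mul _ (ω ^ (n - i)), hz _ ((hmem n).1 hx), _root_.zpow_one, one_mul]

end IsNonsplitPair

namespace IsNonsplitPair

variable {G A : Type*} [Group G] [CommGroup A] {p : ℕ} {ω t : G} {δ : G →* A}

theorem map_smul (g : ConjAct G) (x : G) : δ (g • x) = δ x := by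
  rw [ConjAct.smul_def, map_mul, map_mul, map_inv, mul_inv_cancel_comm]

/-- The determinant separates the two classes of subgroups with the same exponent `e`. -/
theorem smul_sub_ne (h : IsNonsplitPair p ω t δ) {e k : ℕ} (hk : 0 < k)
    (hgcd : e.gcd (2 * p) = 2 * k) (h₀ : (e : ℤ) ∣ 0 * (2 * p + 2))
    (h₁ : (e : ℤ) ∣ k * (2 * p + 2)) (g : ConjAct G) :
    g • h.sub e 0 h₀ ≠ h.sub e k h₁ := by
  intro heq
  have he : (2 * k : ℤ) ∣ e := by exact_mod_cast hgcd ▸ Nat.gcd_dvd_left e (2 * p)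
  have hp : 2 * k ∣ 2 * p := hgcd ▸ Nat.gcd_dvd_right e (2 * p)
  have hδ (a b : ℤ) : δ ω ^ a = δ ω ^ b → (2 * k : ℤ) ∣ b - a := fun hab => by
    rw [zpow_eq_zpow_iff_modEq, h.order_map, Int.modEq_iff_dvd] at hab
    exact dvd_trans (by exact_mod_cast hp) hab
  have hδ₁ (n : ℤ) : δ (ω ^ n) = δ ω ^ n := map_zpow δ ω n
  have hδ₂ (n : ℤ) : δ (ω ^ n * t) = δ ω ^ (n + p) := by
    rw [map_mul, hδ₁, h.map_t, _root_.zpow_add, zpow_natCast]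
  have hnk (c : ℤ) : ¬ (2 * k : ℤ) ∣ k * (2 * c + 1) := by
    rintro ⟨d, hd⟩
    have h1 : (k : ℤ) * (2 * c + 1) = k * (2 * d) := by linear_combination hd
    have := mul_left_cancel₀ (by exact_mod_cast hk.ne') h1
    omega
  obtain ⟨w, rfl⟩ : k ∣ p := Nat.dvd_of_mul_dvd_mul_left two_pos hp
  rcases Nat.even_or_odd' w with ⟨v, rfl | rfl⟩
  · have hy : ω ^ (k : ℤ) * t ∈ g • h.sub e 0 h₀ := by
      rw [heq]
      exact ⟨k, Or.inr ⟨by simp, rfl⟩⟩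
    rw [Subgroup.mem_smul_pointwise_iff_exists] at hy
    obtain ⟨s, ⟨n, ⟨hn, rfl⟩ | ⟨hn, rfl⟩⟩, hs⟩ := hy
    · replace hs := congrArg δ hs
      rw [map_smul, hδ₁, hδ₂] at hs
      refine hnk v ?_
      rw [show (k : ℤ) * (2 * v + 1) = k + (k * (2 * v) : ℕ) - n + n by push_cast; ring]
      exact dvd_add (hδ _ _ hs) (he.trans hn)
    · replace hs := congrArg δ hs
      rw [map_smul, hδ₂, hδ₂] at hs
      refine hnk 0 ?_
      rw [show (k : ℤ) * (2 * 0 + 1) = k + (k * (2 * v) : ℕ) - (n + (k * (2 * v) : ℕ)) + (n - 0) by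
        ring]
      exact dvd_add (hδ _ _ hs) (he.trans hn)
  · have hy : g • t ∈ h.sub e k h₁ := by
      rw [← heq, Subgroup.smul_mem_pointwise_smul_iff]
      exact ⟨0, Or.inr ⟨by simp, by simp⟩⟩
    obtain ⟨n, ⟨hn, hs⟩ | ⟨hn, hs⟩⟩ := hy
    · replace hs := congrArg δ hs
      rw [map_smul, hδ₁, h.map_t, ← zpow_natCast] at hs
      refine hnk v ?_
      rw [show (k : ℤ) * (2 * v + 1) = n - (n - (k * (2 * v + 1) : ℕ)) by push_cast; ring]
      exact dvd_sub (he.trans hn) (hδ _ _ hs)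
    · replace hs := congrArg δ hs
      rw [map_smul, hδ₂, h.map_t, ← zpow_natCast] at hs
      refine hnk 0 ?_
      rw [show (k : ℤ) * (2 * 0 + 1) =
        n + (k * (2 * v + 1) : ℕ) - (k * (2 * v + 1) : ℕ) - (n - k) by ring]
      exact dvd_sub (hδ _ _ hs) (he.trans hn)

theorem nonempty_smul_map_mulEquiv (g : ConjAct G) (K : Subgroup G) :
    Nonempty (K.map (QuotientGroup.mk' (Subgroup.center G)) ≃*
      (g • K).map (QuotientGroup.mk' (Subgroup.center G))) := by
  set π := QuotientGroup.mk' (Subgroup.center G)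
  let c : G ⧸ Subgroup.center G ≃* G ⧸ Subgroup.center G := MulAut.conj (π (ConjAct.ofConjAct g))
  have heq : (g • K).map π = (K.map π).map c.toMonoidHom := by
    change Subgroup.map π (Subgroup.map (MulDistribMulAction.toMonoidHom G g) K) = _
    rw [Subgroup.map_map, Subgroup.map_map]
    congr 1
  rw [heq]
  exact ⟨(K.map π).equivMapOfInjective _ c.injective⟩

/-- Conjugacy classes of subgroups of the normalizer of a nonsplit Cartan subgroup with dihedral
projective image are counted by the admissible exponents, with multiplicity. -/
theorem conjClassCount_eq (h : IsNonsplitPair p ω t δ) (P : Subgroup G → Prop)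
    (hP : ∀ K, P K ↔
      (∃ c : G, ∀ x ∈ K, ∃ n : ℤ, c * x * c⁻¹ = ω ^ n ∨ c * x * c⁻¹ = ω ^ n * t) ∧
      ∃ m : ℕ, 2 ≤ m ∧
        Nonempty (K.map (QuotientGroup.mk' (Subgroup.center G)) ≃* DihedralGroup m)) :
    conjClassCount P = ∑ e ∈ exponents p, classMult p e := by
  have hexp {e : ℕ} (he : e ∈ exponents p) :
      e ∣ 4 * (p * (p + 1)) ∧ ¬ (2 * p + 2) ∣ e ∧ 0 < e := by
    simp only [exponents, Finset.mem_filter, Nat.mem_divisors] at he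
    exact ⟨he.1.1, he.2, Nat.pos_of_dvd_of_pos he.1.1 (Nat.pos_of_ne_zero he.1.2)⟩
  let κ (e : ℕ) : ℕ := e / e.gcd (2 * p + 2)
  have hκ (e : ℕ) : κ e * e.gcd (2 * p + 2) = e := Nat.div_mul_cancel (Nat.gcd_dvd_left _ _)
  have hgcd {e : ℕ} (he : e ∈ exponents p) : e.gcd (2 * p) = κ e * classMult p e := by
    have h1 := gcd_mul_gcd_eq p e h.pos (hexp he).1
    have h2 : 0 < e.gcd (2 * p + 2) := Nat.gcd_pos_of_pos_left _ (hexp he).2.2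
    refine Nat.eq_of_mul_eq_mul_right h2 ?_
    rw [h1, mul_right_comm, hκ]
  have hdvd (e : ℕ) (b : ℤ) : (e : ℤ) ∣ b * κ e * (2 * p + 2) := by
    rw [mul_assoc]
    refine Dvd.dvd.mul_left ?_ _
    have h1 : κ e * e.gcd (2 * p + 2) ∣ κ e * (2 * p + 2) :=
      Nat.mul_dvd_mul_left _ (Nat.gcd_dvd_right _ _)
    rw [hκ] at h1
    exact_mod_cast h1
  let s := (exponents p).sigma fun e => Finset.range (classMult p e)
  have hs : s.card = ∑ e ∈ exponents p, classMult p e := by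
    simp [s, Finset.card_sigma]
  have hPsub {e : ℕ} (he : e ∈ exponents p) (b : ℤ) : P (h.sub e (b * κ e) (hdvd e b)) := by
    rw [hP]
    refine ⟨⟨1, ?_⟩, h.nonempty_map_sub_mulEquiv (hexp he).2.1 _⟩
    rintro _ ⟨n, ⟨-, rfl⟩ | ⟨-, rfl⟩⟩
    · exact ⟨n, Or.inl (by simp)⟩
    · exact ⟨n, Or.inr (by simp)⟩
  let F : s → Quotient (Setoid.comap (Subtype.val : {H : Subgroup G // P H} → Subgroup G)
      (MulAction.orbitRel (ConjAct G) (Subgroup G))) := fun x =>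
    Quotient.mk _ ⟨h.sub x.1.1 ((x.1.2 : ℤ) * κ x.1.1) (hdvd _ _),
      hPsub (Finset.mem_sigma.1 x.2).1 _⟩
  have hne {e : ℕ} (he : e ∈ exponents p) (hc : classMult p e = 2) (g : ConjAct G) :
      g • h.sub e ((0 : ℕ) * κ e) (hdvd _ _) ≠ h.sub e ((1 : ℕ) * κ e) (hdvd _ _) := by
    have h1 : 0 < κ e := Nat.pos_of_ne_zero fun h0 => by
      have := hκ e
      rw [h0, zero_mul] at this
      exact (hexp he).2.2.ne this
    have h2 := h.smul_sub_ne h1 (by rw [hgcd he, hc, mul_comm])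
      (by simp) (by simpa using hdvd e 1) g
    simpa only [Nat.cast_zero, zero_mul, Nat.cast_one, one_mul] using h2
  have hF : Function.Bijective F := by
    constructor
    · rintro ⟨⟨e, b⟩, hx⟩ ⟨⟨e', b'⟩, hx'⟩ hFx
      obtain ⟨he, hb⟩ := Finset.mem_sigma.1 hx
      obtain ⟨he', hb'⟩ := Finset.mem_sigma.1 hx'
      obtain ⟨g, hg⟩ := Quotient.exact hFx
      simp only at he he' hb hb' hg
      change g • h.sub e' (b' * κ e') (hdvd _ _) = h.sub e (b * κ e) (hdvd _ _) at hg
      obtain rfl : e = e' := by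
        have h1 := Nat.card_congr
          (Subgroup.equivSMul g (h.sub e' (b' * κ e') (hdvd _ _))).toEquiv
        rw [hg, h.card_sub (hexp he).1, h.card_sub (hexp he').1] at h1
        have h2 := Nat.div_mul_cancel (hexp he).1
        have h3 := Nat.div_mul_cancel (hexp he').1
        rw [Nat.eq_of_mul_eq_mul_left two_pos h1] at h3
        refine Nat.eq_of_mul_eq_mul_left (Nat.div_pos (Nat.le_of_dvd ?_ (hexp he).1)
          (hexp he).2.2) (h2.trans h3.symm)
        have := h.pos
        positivity
      obtain rfl : b = b' := by
        rw [Finset.mem_range] at hb hb'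
        have h2 := classMult_le_two p e
        by_contra hbb
        have hc : classMult p e = 2 := by omega
        obtain ⟨rfl, rfl⟩ | ⟨rfl, rfl⟩ : b = 0 ∧ b' = 1 ∨ b = 1 ∧ b' = 0 := by omega
        · exact hne he hc g⁻¹ (inv_smul_eq_iff.2 hg.symm)
        · exact hne he hc g hg
      rfl
    · intro q
      induction q using Quotient.inductionOn with | _ K
      obtain ⟨K, hK⟩ := K
      obtain ⟨⟨c, hc⟩, m, hm, ⟨φ⟩⟩ := (hP K).1 hK
      obtain ⟨ψ⟩ := nonempty_smul_map_mulEquiv (ConjAct.toConjAct c) K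
      obtain ⟨e, he, i, hi, heq⟩ := h.exists_eq_sub (K := ConjAct.toConjAct c • K) (by
        intro x hx
        rw [Subgroup.mem_smul_pointwise_iff_exists] at hx
        obtain ⟨y, hy, rfl⟩ := hx
        exact hc y hy) hm ⟨ψ.symm.trans φ⟩
      have hκi : (κ e : ℤ) ∣ i := by
        have hg : 0 < e.gcd (2 * p + 2) := Nat.gcd_pos_of_pos_left _ (hexp he).2.2
        have hcop : IsCoprime (κ e : ℤ) (((2 * p + 2) / e.gcd (2 * p + 2) : ℕ) : ℤ) :=
          Nat.isCoprime_iff_coprime.2 (Nat.coprime_div_gcd_div_gcd hg)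
        refine hcop.dvd_of_dvd_mul_right ?_
        refine Int.dvd_of_mul_dvd_mul_right (a := (e.gcd (2 * p + 2) : ℤ))
          (by exact_mod_cast hg.ne') ?_
        have h1 : (2 * p + 2) / e.gcd (2 * p + 2) * e.gcd (2 * p + 2) = 2 * p + 2 :=
          Nat.div_mul_cancel (Nat.gcd_dvd_right _ _)
        rw [mul_assoc]
        exact_mod_cast (by rw [h1, hκ]; exact_mod_cast hi :
          ((κ e * e.gcd (2 * p + 2) : ℕ) : ℤ) ∣
            i * (((2 * p + 2) / e.gcd (2 * p + 2) * e.gcd (2 * p + 2) : ℕ) : ℤ))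
      obtain ⟨j, rfl⟩ := hκi
      have hpos : 0 < classMult p e := by unfold classMult; split_ifs <;> norm_num
      have hb0 := Int.emod_nonneg j (b := (classMult p e : ℤ)) (by exact_mod_cast hpos.ne')
      have hb1 := Int.emod_lt_of_pos j (b := (classMult p e : ℤ)) (by exact_mod_cast hpos)
      obtain ⟨b, hb⟩ := Int.eq_ofNat_of_zero_le hb0
      obtain ⟨g, hg⟩ := h.exists_smul_sub_eq hi (hdvd e b) (by
        rw [show Int.gcd e (2 * p) = κ e * classMult p e from hgcd he, Nat.cast_mul,
          mul_comm (b : ℤ), ← mul_sub, ← hb]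
        exact mul_dvd_mul_left _ Int.dvd_self_sub_emod)
      have hbr : b < classMult p e := by omega
      refine ⟨⟨⟨e, b⟩, Finset.mem_sigma.2 ⟨he, Finset.mem_range.2 hbr⟩⟩, ?_⟩
      refine Quotient.sound ⟨g⁻¹ * ConjAct.toConjAct c, ?_⟩
      change (g⁻¹ * ConjAct.toConjAct c) • K = h.sub e (b * κ e) (hdvd _ _)
      rw [mul_smul, heq, ← hg, inv_smul_smul]
  rw [conjClassCount, ← hs, ← Nat.card_eq_of_bijective F hF, Nat.card_eq_fintype_card,
    Fintype.card_coe]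

end IsNonsplitPair

section NonsplitCartan

/-- The matrix `[[1, 0], [0, -1]]`. -/
def reflection (ℓ : ℕ) : GL2 ℓ where
  val := !![1, 0; 0, -1]
  inv := !![1, 0; 0, -1]
  val_inv := by ext i j; fin_cases i <;> fin_cases j <;> simp
  inv_val := by ext i j; fin_cases i <;> fin_cases j <;> simp

theorem reflection_mul_self {ℓ : ℕ} : reflection ℓ * reflection ℓ = 1 :=
  Units.ext (reflection ℓ).val_inv

variable {ℓ p : ℕ} [Fact (Nat.Prime ℓ)] {ε : ZMod ℓ}

/-- The matrix of multiplication by an element of `𝔽_ℓ(√ε)`. -/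
def quadraticMatrix (ε : ZMod ℓ) :
    QuadraticAlgebra (ZMod ℓ) ε 0 →* Matrix (Fin 2) (Fin 2) (ZMod ℓ) where
  toFun z := !![z.re, ε * z.im; z.im, z.re]
  map_one' := by
    ext i j
    fin_cases i <;> fin_cases j <;> simp [QuadraticAlgebra.re_one, QuadraticAlgebra.im_one]
  map_mul' z w := by
    ext i j
    fin_cases i <;> fin_cases j <;> simp [Matrix.mul_apply, Fin.sum_univ_two] <;> ring

/-- The multiplicative group of `𝔽_ℓ(√ε)` as a group of matrices. -/
def cartan (ε : ZMod ℓ) : (QuadraticAlgebra (ZMod ℓ) ε 0)ˣ →* GL2 ℓ :=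
  Units.map (quadraticMatrix ε)

theorem cartan_injective : Function.Injective (cartan ε) := by
  intro u v huv
  have h : quadraticMatrix ε u = quadraticMatrix ε v := congrArg Units.val huv
  ext
  · simpa [quadraticMatrix] using congrFun (congrFun h 0) 0
  · simpa [quadraticMatrix] using congrFun (congrFun h 1) 0

theorem isNSElt_cartan (u : (QuadraticAlgebra (ZMod ℓ) ε 0)ˣ) : IsNSElt ε (cartan ε u) := by
  simp [IsNSElt, mat, cartan, quadraticMatrix]

theorem isNSElt_mul_reflection_iff (g : GL2 ℓ) :
    IsNSElt ε (g * reflection ℓ) ↔ IsNSCosetElt ε g := by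
  simp [IsNSElt, IsNSCosetElt, mat, reflection, Matrix.mul_apply, Fin.sum_univ_two,
    neg_eq_iff_eq_neg]

theorem reflection_mul_cartan (u v : (QuadraticAlgebra (ZMod ℓ) ε 0)ˣ)
    (huv : (v : QuadraticAlgebra (ZMod ℓ) ε 0) = star (u : QuadraticAlgebra (ZMod ℓ) ε 0)) :
    reflection ℓ * cartan ε u = cartan ε v * reflection ℓ := by
  ext i j
  fin_cases i <;> fin_cases j <;>
    simp [reflection, cartan, quadraticMatrix, Matrix.mul_apply, Fin.sum_univ_two, huv]

theorem cartan_mem_center_iff (hp : ℓ = 2 * p + 1) (u : (QuadraticAlgebra (ZMod ℓ) ε 0)ˣ) :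
    cartan ε u ∈ Subgroup.center (GL2 ℓ) ↔
      reflection ℓ * cartan ε u = cartan ε u * reflection ℓ := by
  constructor
  · intro h
    exact Subgroup.mem_center_iff.1 h _
  · intro h
    have h2 : (2 : ZMod ℓ) ≠ 0 := by
      intro h0
      have h1 : ((2 * p + 1 : ℕ) : ZMod ℓ) = 0 := by rw [← hp]; simp
      push_cast at h1
      rw [h0, zero_mul, zero_add] at h1
      exact one_ne_zero h1
    have h10 := congrArg (fun g : GL2 ℓ => (g : Matrix (Fin 2) (Fin 2) (ZMod ℓ)) 1 0) h
    simp [reflection, cartan, quadraticMatrix, Matrix.mul_apply, Fin.sum_univ_two] at h10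
    have him : (u : QuadraticAlgebra (ZMod ℓ) ε 0).im = 0 := by
      have : 2 * (u : QuadraticAlgebra (ZMod ℓ) ε 0).im = 0 := by linear_combination -h10
      exact (mul_eq_zero.1 this).resolve_left h2
    rw [Matrix.GeneralLinearGroup.mem_center_iff_val_mem_range_scalar]
    refine ⟨(u : QuadraticAlgebra (ZMod ℓ) ε 0).re, ?_⟩
    ext i j
    fin_cases i <;> fin_cases j <;> simp [cartan, quadraticMatrix, him]

theorem det_cartan (u : (QuadraticAlgebra (ZMod ℓ) ε 0)ˣ) :
    ((Matrix.GeneralLinearGroup.det (cartan ε u) : (ZMod ℓ)ˣ) : ZMod ℓ) =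
      QuadraticAlgebra.norm (u : QuadraticAlgebra (ZMod ℓ) ε 0) := by
  simp [cartan, quadraticMatrix, QuadraticAlgebra.norm_def, Matrix.det_fin_two]

theorem det_reflection : Matrix.GeneralLinearGroup.det (reflection ℓ) = -1 := by
  ext
  simp [reflection, Matrix.det_fin_two]

theorem pow_eq_star (hp : ℓ = 2 * p + 1) (hε : ¬ IsSquare ε)
    (z : QuadraticAlgebra (ZMod ℓ) ε 0) : z ^ ℓ = star z := by
  have hε0 : ε ≠ 0 := by rintro rfl; exact hε IsSquare.zero
  have hεp : ε ^ p = -1 := by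
    have h1 := (ZMod.euler_criterion ℓ hε0).not.1 hε
    have h2 := ZMod.pow_div_two_eq_neg_one_or_one ℓ hε0
    rw [show ℓ / 2 = p by omega] at h1 h2
    exact h2.resolve_left h1
  have : CharP (QuadraticAlgebra (ZMod ℓ) ε 0) ℓ :=
    charP_of_injective_algebraMap (algebraMap (ZMod ℓ) _).injective ℓ
  set a := algebraMap (ZMod ℓ) (QuadraticAlgebra (ZMod ℓ) ε 0)
  have hω : (QuadraticAlgebra.omega : QuadraticAlgebra (ZMod ℓ) ε 0) ^ ℓ =
      -QuadraticAlgebra.omega := by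
    have hpow : (QuadraticAlgebra.omega : QuadraticAlgebra (ZMod ℓ) ε 0) ^ ℓ =
        QuadraticAlgebra.omega ^ (2 * p + 1) := congrArg (_ ^ ·) hp
    rw [hpow, pow_succ, pow_mul, pow_two, QuadraticAlgebra.omega_mul_omega_eq_algebraMap, map_zero,
      zero_mul, add_zero, ← map_pow, hεp, map_neg, map_one, neg_one_mul]
  have hz : z = a z.re + a z.im * QuadraticAlgebra.omega := by
    ext <;> simp [a]
  have hzs : star z = a z.re + a z.im * -QuadraticAlgebra.omega := by
    ext <;> simp [a]
  rw [hzs, ← hω]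
  conv_lhs => rw [hz]
  rw [add_pow_char, mul_pow, ← map_pow, ← map_pow, ZMod.pow_card, ZMod.pow_card]

theorem exists_isNonsplitPair (hp : ℓ = 2 * p + 1) (hε : ¬ IsSquare ε) :
    ∃ ω : GL2 ℓ, IsNonsplitPair p ω (reflection ℓ) Matrix.GeneralLinearGroup.det ∧
      ∀ g : GL2 ℓ, IsNSElt ε g ↔ ∃ n : ℤ, g = ω ^ n := by
  have : Fact (∀ r : ZMod ℓ, r ^ 2 ≠ ε + 0 * r) := ⟨fun r hr => hε ⟨r, by
    rw [zero_mul, add_zero] at hr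
    rw [← hr, sq]⟩⟩
  have hℓ : 2 ≤ ℓ := (Fact.out : ℓ.Prime).two_le
  have h2 : (2 : ZMod ℓ) ≠ 0 := by
    intro h0
    have h1 : ((2 * p + 1 : ℕ) : ZMod ℓ) = 0 := by rw [← hp]; simp
    push_cast at h1
    rw [h0, zero_mul, zero_add] at h1
    exact one_ne_zero h1
  have hneg : (-1 : ZMod ℓ) ≠ 1 := fun h => h2 (by linear_combination -h)
  have : Finite (QuadraticAlgebra (ZMod ℓ) ε 0) :=
    Finite.of_equiv _ (QuadraticAlgebra.equivProd ε 0).symm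
  have hcard : Nat.card (QuadraticAlgebra (ZMod ℓ) ε 0) = ℓ * ℓ := by
    rw [Nat.card_congr (QuadraticAlgebra.equivProd ε 0), Nat.card_prod, Nat.card_zmod]
  obtain ⟨u, hu⟩ := IsCyclic.exists_generator (α := (QuadraticAlgebra (ZMod ℓ) ε 0)ˣ)
  have hord : orderOf u = 4 * (p * (p + 1)) := by
    rw [orderOf_eq_card_of_forall_mem_zpowers hu, Nat.card_units, hcard, hp,
      show (2 * p + 1) * (2 * p + 1) = 4 * (p * (p + 1)) + 1 by ring, Nat.add_sub_cancel]
  have hstar (z : (QuadraticAlgebra (ZMod ℓ) ε 0)ˣ) :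
      reflection ℓ * cartan ε z = cartan ε (z ^ (2 * p + 1)) * reflection ℓ :=
    reflection_mul_cartan _ _ (by rw [Units.val_pow_eq_pow_val, ← hp, pow_eq_star hp hε])
  have hiff (g : GL2 ℓ) : IsNSElt ε g ↔ ∃ n : ℤ, g = cartan ε u ^ n := by
    constructor
    · rintro ⟨h1, h2⟩
      have hne : (⟨mat g 0 0, mat g 1 0⟩ : QuadraticAlgebra (ZMod ℓ) ε 0) ≠ 0 := by
        intro h0
        have h00 : mat g 0 0 = 0 := congrArg QuadraticAlgebra.re h0
        have h10 : mat g 1 0 = 0 := congrArg QuadraticAlgebra.im h0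
        have hdet := (Matrix.GeneralLinearGroup.det g).ne_zero
        apply hdet
        change Matrix.det (mat g) = 0
        rw [Matrix.det_fin_two, h00, h10]
        ring
      obtain ⟨n, hn⟩ := hu (Units.mk0 _ hne)
      refine ⟨n, ?_⟩
      simp only at hn
      rw [← map_zpow, hn]
      ext i j
      change mat g i j = _
      fin_cases i <;> fin_cases j <;> simp [cartan, quadraticMatrix, h1, h2]
    · rintro ⟨n, rfl⟩
      rw [← map_zpow]
      exact isNSElt_cartan _
  have horder : orderOf (Matrix.GeneralLinearGroup.det (cartan ε u)) = 2 * p := by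
    let a := algebraMap (ZMod ℓ) (QuadraticAlgebra (ZMod ℓ) ε 0)
    have ha : Function.Injective (Units.map a.toMonoidHom) := Units.map_injective a.injective
    have h1 : Units.map a.toMonoidHom (Matrix.GeneralLinearGroup.det (cartan ε u)) =
        u ^ (2 * p + 2) := by
      ext1
      change a (Matrix.GeneralLinearGroup.det (cartan ε u) : (ZMod ℓ)ˣ) = _
      rw [det_cartan, QuadraticAlgebra.algebraMap_norm_eq_mul_star, ← pow_eq_star hp hε,
        Units.val_pow_eq_pow_val, ← pow_succ']
      exact congrArg ((u : QuadraticAlgebra (ZMod ℓ) ε 0) ^ ·) (congrArg (· + 1) hp)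
    have h3 : 4 * (p * (p + 1)) = 2 * p * (2 * p + 2) := by ring
    rw [← orderOf_injective _ ha, h1, orderOf_pow_of_dvd (by omega) (by rw [hord, h3]; simp), hord,
      h3, Nat.mul_div_cancel _ (by omega)]
  have hp0 : 0 < p := by omega
  refine ⟨cartan ε u, ⟨hp0, ?_, ?_, reflection_mul_self, ?_, ?_, horder, ?_⟩, hiff⟩
  · rw [orderOf_injective _ cartan_injective, hord]
  · rintro ⟨n, hn⟩
    have h1 := ((hiff (reflection ℓ)).2 ⟨n, hn.symm⟩).1
    simp only [mat, reflection] at h1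
    exact hneg (by simpa using h1)
  · rw [SemiconjBy, ← map_pow]
    exact hstar u
  · intro n
    rw [← map_zpow, cartan_mem_center_iff hp, hstar, mul_left_inj, cartan_injective.eq_iff,
      ← zpow_natCast, ← _root_.zpow_mul, zpow_eq_zpow_iff_modEq, hord, Int.modEq_comm,
      Int.modEq_iff_dvd]
    push_cast
    rw [show n * (2 * p + 1) - n = 2 * p * n by ring,
      show (4 * (p * (p + 1)) : ℤ) = 2 * p * (2 * p + 2) by ring]
    exact mul_dvd_mul_iff_left (by positivity)
  · rw [det_reflection]
    set d := Matrix.GeneralLinearGroup.det (cartan ε u)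
    have h1 : (d ^ p) ^ 2 = 1 := by
      rw [← pow_mul, mul_comm, ← horder, pow_orderOf_eq_one]
    have h3 : d ^ p ≠ 1 := by
      rw [Ne, ← orderOf_dvd_iff_pow_eq_one, horder]
      intro h
      have := Nat.le_of_dvd hp0 h
      omega
    have h4 : ((d ^ p : (ZMod ℓ)ˣ) : ZMod ℓ) ^ 2 = 1 := by
      rw [← Units.val_pow_eq_pow_val, h1, Units.val_one]
    rcases eq_or_eq_neg_of_sq_eq_sq ((d ^ p : (ZMod ℓ)ˣ) : ZMod ℓ) 1
      (by rw [h4, one_pow]) with h5 | h5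
    · exact absurd (Units.ext (h5.trans Units.val_one.symm)) h3
    · ext
      rw [h5]
      simp

end NonsplitCartan

/-- Let `ℓ` be an odd prime.  The number of conjugacy classes of subgroups of
`GL₂(ℤ/ℓℤ)` that are conjugate to a subgroup of `C_ns⁺(ℓ)` and have dihedral projective
image equals `τ(ℓ²−1) − τ(ℓ−1) + τ((ℓ²−1)/4) − τ((ℓ−1)/2)`. -/
theorem stmt9 (ℓ : ℕ) [Fact (Nat.Prime ℓ)] (hodd : Odd ℓ)
    (ε : ZMod ℓ) (hε : ¬ IsSquare ε) :
    conjClassCount (fun H : Subgroup (GL2 ℓ) =>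
        (∃ c : GL2 ℓ, ∀ x ∈ H, IsNSPlusElt ε (c * x * c⁻¹)) ∧ IsDihedralProj H) =
      tauFun (ℓ ^ 2 - 1) - tauFun (ℓ - 1) + tauFun ((ℓ ^ 2 - 1) / 4) -
        tauFun ((ℓ - 1) / 2) := by
  obtain ⟨p, hp⟩ := hodd
  obtain ⟨ω, hω, hns⟩ := exists_isNonsplitPair hp hε
  have hplus (g : GL2 ℓ) : IsNSPlusElt ε g ↔ ∃ n : ℤ, g = ω ^ n ∨ g = ω ^ n * reflection ℓ := by
    rw [IsNSPlusElt, ← isNSElt_mul_reflection_iff, hns, hns, ← exists_or]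
    refine exists_congr fun n => or_congr_right ?_
    rw [← eq_mul_inv_iff_mul_eq, inv_eq_of_mul_eq_one_left reflection_mul_self]
  have hcount := hω.conjClassCount_eq
    (fun H : Subgroup (GL2 ℓ) =>
      (∃ c : GL2 ℓ, ∀ x ∈ H, IsNSPlusElt ε (c * x * c⁻¹)) ∧ IsDihedralProj H)
    (fun K => and_congr (exists_congr fun c => forall₂_congr fun x _ => hplus _) Iff.rfl)
  have h1 : ℓ ^ 2 - 1 = 4 * (p * (p + 1)) := by
    rw [hp, show (2 * p + 1) ^ 2 = 4 * (p * (p + 1)) + 1 by ring, Nat.add_sub_cancel]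
  have h2 : ℓ - 1 = 2 * p := by omega
  rw [hcount, sum_classMult p hω.pos, h1, h2, Nat.mul_div_cancel_left _ (by norm_num),
    Nat.mul_div_cancel_left _ (by norm_num)]
  rfl
end

section
/- Let ℓ be an odd prime. The number of conjugacy classes of subgroups of GL₂(ℤ/ℓℤ) that are conjugate to a subgroup of C_s⁺(ℓ) and have dihedral projective image equals β(ℓ−1) − τ(ℓ−1) + τ((ℓ−1)/2)² − τ((ℓ−1)/2) − c, where c = τ((ℓ−1)/4) if ℓ ≡ 1 (mod 4) and c = 0 if ℓ ≡ 3 (mod 4). -/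
open Matrix Pointwise

/-- Membership in the split Cartan group `C_s(ℓ)` of diagonal matrices. -/
def IsDiagElt {ℓ : ℕ} (g : GL2 ℓ) : Prop := mat g 0 1 = 0 ∧ mat g 1 0 = 0

/-- Antidiagonal matrices: the nontrivial coset of `C_s(ℓ)` in its normalizer. -/
def IsAntidiagElt {ℓ : ℕ} (g : GL2 ℓ) : Prop := mat g 0 0 = 0 ∧ mat g 1 1 = 0

/-- Membership in `C_s⁺(ℓ)`, the normalizer of `C_s(ℓ)` in `GL₂(ℤ/ℓℤ)`, generated by
`C_s(ℓ)` and `[[0,1],[1,0]]`; it consists of the diagonal and antidiagonal matrices. -/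
def IsCsPlusElt {ℓ : ℕ} (g : GL2 ℓ) : Prop := IsDiagElt g ∨ IsAntidiagElt g

/-- `β(n) = β₂(n) · ∏_{p odd prime, p | n} (v_p(n)+1)²`, where
`β₂(n) = 2·v₂(n)² − 2·v₂(n) + 3` if `n` is even and `β₂(n) = 1` if `n` is odd. -/
def betaFun (n : ℕ) : ℕ :=
  (if 2 ∣ n then 2 * (n.factorization 2) ^ 2 - 2 * (n.factorization 2) + 3 else 1) *
    ∏ p ∈ n.primeFactors.erase 2, (n.factorization p + 1) ^ 2

section Matrices

variable {ℓ : ℕ}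

/-- Diagonal matrices, as a homomorphism from pairs of units. -/
def dg : (ZMod ℓ)ˣ × (ZMod ℓ)ˣ →* GL2 ℓ where
  toFun x := ⟨!![(x.1 : ZMod ℓ), 0; 0, x.2],
    !![((x.1⁻¹ : (ZMod ℓ)ˣ) : ZMod ℓ), 0; 0, (x.2⁻¹ : (ZMod ℓ)ˣ)],
    by simp [Matrix.one_fin_two], by simp [Matrix.one_fin_two]⟩
  map_one' := by ext i j; fin_cases i <;> fin_cases j <;> simp
  map_mul' x y := by ext i j; fin_cases i <;> fin_cases j <;> simp

/-- Antidiagonal matrices. -/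
def ad (p q : (ZMod ℓ)ˣ) : GL2 ℓ :=
  ⟨!![0, (p : ZMod ℓ); q, 0], !![0, ((q⁻¹ : (ZMod ℓ)ˣ) : ZMod ℓ); (p⁻¹ : (ZMod ℓ)ˣ), 0],
    by simp [Matrix.one_fin_two], by simp [Matrix.one_fin_two]⟩

@[simp] lemma mat_dg (x : (ZMod ℓ)ˣ × (ZMod ℓ)ˣ) : mat (dg x) = !![(x.1 : ZMod ℓ), 0; 0, x.2] := rfl

@[simp] lemma mat_ad (p q : (ZMod ℓ)ˣ) : mat (ad p q) = !![0, (p : ZMod ℓ); q, 0] := rfl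

lemma mat_injective : Function.Injective (mat : GL2 ℓ → _) := Units.val_injective

lemma mat_mul (g h : GL2 ℓ) : mat (g * h) = mat g * mat h := rfl

lemma dg_mul_ad (x : (ZMod ℓ)ˣ × (ZMod ℓ)ˣ) (p q : (ZMod ℓ)ˣ) :
    dg x * ad p q = ad (x.1 * p) (x.2 * q) := by
  apply mat_injective; simp [mat_mul]

lemma ad_mul_dg (x : (ZMod ℓ)ˣ × (ZMod ℓ)ˣ) (p q : (ZMod ℓ)ˣ) :
    ad p q * dg x = ad (p * x.2) (q * x.1) := by
  apply mat_injective; simp [mat_mul]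

lemma ad_mul_ad (p q r s : (ZMod ℓ)ˣ) : ad p q * ad r s = dg (p * s, q * r) := by
  apply mat_injective; simp [mat_mul]

lemma ad_inv (p q : (ZMod ℓ)ˣ) : (ad p q)⁻¹ = ad q⁻¹ p⁻¹ := by
  rw [inv_eq_iff_mul_eq_one, ad_mul_ad, mul_inv_cancel, mul_inv_cancel]
  exact map_one dg

lemma dg_injective : Function.Injective (dg : _ → GL2 ℓ) := by
  intro x y h
  have h' := congrArg mat h
  simp only [mat_dg] at h'
  have h0 := congrFun (congrFun h' 0) 0
  have h1 := congrFun (congrFun h' 1) 1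
  simp at h0 h1
  exact Prod.ext (Units.ext h0) (Units.ext h1)

variable [Fact ℓ.Prime]

lemma dg_ne_ad (x : (ZMod ℓ)ˣ × (ZMod ℓ)ˣ) (p q : (ZMod ℓ)ˣ) : dg x ≠ ad p q := by
  intro h
  have h0 := congrFun (congrFun (congrArg mat h) 0) 0
  simp at h0

lemma ad_injective {p q r s : (ZMod ℓ)ˣ} (h : ad p q = ad r s) : p = r ∧ q = s := by
  have h' := congrArg mat h
  have h0 := congrFun (congrFun h' 0) 1
  have h1 := congrFun (congrFun h' 1) 0
  simp at h0 h1
  exact ⟨Units.ext h0, Units.ext h1⟩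

lemma det_mat_ne_zero (g : GL2 ℓ) : (mat g).det ≠ 0 :=
  ((Matrix.isUnit_iff_isUnit_det _).1 g.isUnit).ne_zero

lemma isDiagElt_iff (g : GL2 ℓ) : IsDiagElt g ↔ ∃ x, g = dg x := by
  constructor
  · rintro ⟨h1, h2⟩
    have hd := det_mat_ne_zero g
    rw [Matrix.det_fin_two, h1, zero_mul, sub_zero] at hd
    refine ⟨(Units.mk0 _ (left_ne_zero_of_mul hd), Units.mk0 _ (right_ne_zero_of_mul hd)), ?_⟩
    apply mat_injective
    ext i j; fin_cases i <;> fin_cases j <;> simp [h1, h2]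
  · rintro ⟨x, rfl⟩
    simp [IsDiagElt]

lemma isAntidiagElt_iff (g : GL2 ℓ) : IsAntidiagElt g ↔ ∃ p q, g = ad p q := by
  constructor
  · rintro ⟨h1, h2⟩
    have hd := det_mat_ne_zero g
    rw [Matrix.det_fin_two, h1, zero_mul, zero_sub, neg_ne_zero] at hd
    refine ⟨Units.mk0 _ (left_ne_zero_of_mul hd), Units.mk0 _ (right_ne_zero_of_mul hd), ?_⟩
    apply mat_injective
    ext i j; fin_cases i <;> fin_cases j <;> simp [h1, h2]
  · rintro ⟨p, q, rfl⟩
    simp [IsAntidiagElt]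

lemma isCsPlusElt_iff (g : GL2 ℓ) : IsCsPlusElt g ↔ (∃ x, g = dg x) ∨ ∃ p q, g = ad p q := by
  rw [IsCsPlusElt, isDiagElt_iff, isAntidiagElt_iff]

lemma mem_center_GL2_iff (g : GL2 ℓ) : g ∈ Subgroup.center (GL2 ℓ) ↔ ∃ z, g = dg (z, z) := by
  rw [Matrix.GeneralLinearGroup.center_eq_range_scalar, MonoidHom.mem_range]
  refine exists_congr fun z => ?_
  rw [eq_comm]
  have : Matrix.GeneralLinearGroup.scalar (Fin 2) z = dg (z, z) := by
    apply mat_injective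
    ext i j; fin_cases i <;> fin_cases j <;> simp [mat] <;> rfl
  rw [this]

lemma dg_mem_center_iff (x : (ZMod ℓ)ˣ × (ZMod ℓ)ˣ) :
    dg x ∈ Subgroup.center (GL2 ℓ) ↔ x.1 = x.2 := by
  rw [mem_center_GL2_iff]
  constructor
  · rintro ⟨z, h⟩
    rw [dg_injective h]
  · intro h
    exact ⟨x.1, by rw [show x = (x.1, x.1) from Prod.ext rfl h.symm]⟩

lemma ad_not_mem_center (p q : (ZMod ℓ)ˣ) : ad p q ∉ Subgroup.center (GL2 ℓ) := by
  rw [mem_center_GL2_iff]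
  rintro ⟨z, h⟩
  exact dg_ne_ad _ _ _ h.symm

end Matrices

section UnitsFacts

variable {ℓ : ℕ} [Fact ℓ.Prime]

lemma unit_eq_one_or_neg_one {x : (ZMod ℓ)ˣ} (h : x ^ 2 = 1) : x = 1 ∨ x = -1 := by
  have : (x : ZMod ℓ) * x = 1 := by
    rw [← sq, ← Units.val_pow_eq_pow_val, h, Units.val_one]
  rcases mul_self_eq_one_iff.1 this with h | h
  · exact Or.inl (Units.ext h)
  · exact Or.inr (Units.ext (by simpa using h))

lemma neg_one_ne_one_units (hodd : Odd ℓ) : (-1 : (ZMod ℓ)ˣ) ≠ 1 := by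
  have : Fact (2 < ℓ) := ⟨by
    have := (Fact.out : ℓ.Prime).two_le
    rcases hodd with ⟨k, rfl⟩; omega⟩
  intro h
  exact ZMod.neg_one_ne_one (n := ℓ) (by simpa using congrArg Units.val h)

lemma isSquare_unit_iff (hodd : Odd ℓ) (x : (ZMod ℓ)ˣ) :
    (∃ y, y ^ 2 = x) ↔ x ^ ((ℓ - 1) / 2) = 1 := by
  rw [ZMod.euler_criterion_units, show ℓ / 2 = (ℓ - 1) / 2 by rcases hodd with ⟨k, rfl⟩; omega]

lemma exists_orderOf_eq {m : ℕ} (hm : m ∣ ℓ - 1) : ∃ x : (ZMod ℓ)ˣ, orderOf x = m := by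
  obtain ⟨g, hg⟩ := IsCyclic.exists_ofOrder_eq_natCard (α := (ZMod ℓ)ˣ)
  rw [Nat.card_eq_fintype_card, ZMod.card_units] at hg
  obtain ⟨k, hk⟩ := hm
  have h0 : ℓ - 1 ≠ 0 := by have := (Fact.out : ℓ.Prime).two_le; omega
  have hk0 : k ≠ 0 := by rintro rfl; simp at hk; omega
  refine ⟨g ^ k, ?_⟩
  rw [orderOf_pow_of_dvd hk0 (by rw [hg, hk]; exact Dvd.intro_left _ rfl), hg, hk]
  exact Nat.mul_div_cancel _ (Nat.pos_of_ne_zero hk0)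

lemma pow_half_orderOf {x : (ZMod ℓ)ˣ} (h : 2 ∣ orderOf x) : x ^ (orderOf x / 2) = -1 := by
  have h0 : 0 < orderOf x := orderOf_pos x
  refine (unit_eq_one_or_neg_one (x := x ^ (orderOf x / 2)) ?_).resolve_left fun h1 => ?_
  · rw [← pow_mul, Nat.div_mul_cancel h, pow_orderOf_eq_one]
  · have := Nat.le_of_dvd (by omega) (orderOf_dvd_of_pow_eq_one h1)
    omega

/-- A subgroup of the units is determined by its order. -/
lemma mem_iff_pow_card (D : Subgroup (ZMod ℓ)ˣ) (z : (ZMod ℓ)ˣ) :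
    z ∈ D ↔ z ^ Nat.card D = 1 := by
  have hle : D ≤ (powMonoidHom (Nat.card D) : (ZMod ℓ)ˣ →* _).ker := by
    intro x hx
    have := pow_card_eq_one' (G := D) (x := ⟨x, hx⟩)
    exact congrArg Subtype.val this
  have : D = (powMonoidHom (Nat.card D) : (ZMod ℓ)ˣ →* _).ker := by
    apply Subgroup.eq_of_le_of_card_ge hle
    rw [IsCyclic.card_powMonoidHom_ker]
    exact Nat.le_of_dvd Nat.card_pos (Nat.gcd_dvd_right _ _)
  conv_lhs => rw [this]
  simp [MonoidHom.mem_ker]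

lemma exists_sq_of_pow_half {d : ℕ} (hodd : Odd ℓ) (hd : 2 ∣ d) (hdn : d ∣ ℓ - 1)
    {x : (ZMod ℓ)ˣ} (h : x ^ (d / 2) = 1) : ∃ s, s ^ d = 1 ∧ s ^ 2 = x := by
  obtain ⟨e, rfl⟩ := hd
  obtain ⟨k, hk⟩ := hdn
  rw [Nat.mul_div_cancel_left _ two_pos] at h
  obtain ⟨s, hs⟩ := (isSquare_unit_iff hodd x).2 (by
    rw [hk, mul_assoc, Nat.mul_div_cancel_left _ two_pos, pow_mul, h, one_pow])
  exact ⟨s, by rw [pow_mul, hs, h], hs⟩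

end UnitsFacts

section Dihedral

lemma nonempty_mulEquiv_dihedralGroup_s10 {Q : Type*} [Group Q] (K : Subgroup Q) (r s : Q) (m : ℕ)
    [NeZero m] (hr : orderOf r = m) (hs : s * s = 1) (hsr : s * r * s = r⁻¹)
    (hns : s ∉ Subgroup.zpowers r) (hrK : r ∈ K) (hsK : s ∈ K)
    (hK : ∀ x ∈ K, x ∈ Subgroup.zpowers r ∨ s * x ∈ Subgroup.zpowers r) :
    Nonempty (K ≃* DihedralGroup m) := by
  have hadd (i j : ZMod m) : r ^ (i + j).val = r ^ i.val * r ^ j.val := by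
    rw [← pow_add, pow_eq_pow_iff_modEq, hr, ZMod.val_add]
    exact Nat.mod_modEq _ _
  have hneg (i : ZMod m) : r ^ (-i).val = (r ^ i.val)⁻¹ := by
    rw [eq_comm, inv_eq_iff_mul_eq_one, ← hadd, add_neg_cancel, ZMod.val_zero, pow_zero]
  have hsinv : s⁻¹ = s := inv_eq_of_mul_eq_one_left hs
  have hconj (k : ℕ) : s * r ^ k * s = (r ^ k)⁻¹ := by
    have := conj_pow (i := k) (a := s) (b := r)
    rw [hsinv, hsr] at this
    rw [← this, inv_pow]
  have hcomm (k : ℕ) : r ^ k * s = s * (r ^ k)⁻¹ := by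
    rw [← hconj, ← mul_assoc, ← mul_assoc, hs, one_mul]
  let f : DihedralGroup m →* Q := MonoidHom.mk'
    (fun x => match x with
      | .r i => r ^ i.val
      | .sr i => s * r ^ i.val) (by
    rintro (i | i) (j | j)
    · exact hadd i j
    · change s * r ^ (j - i).val = r ^ i.val * (s * r ^ j.val)
      rw [← mul_assoc, hcomm, sub_eq_neg_add, hadd, hneg, mul_assoc]
    · change s * r ^ (i + j).val = s * r ^ i.val * r ^ j.val
      rw [hadd, mul_assoc]
    · change r ^ (j - i).val = s * r ^ i.val * (s * r ^ j.val)
      rw [← mul_assoc, hconj, sub_eq_neg_add, hadd, hneg])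
  have hf1 (i : ZMod m) : f (.r i) = r ^ i.val := rfl
  have hf2 (i : ZMod m) : f (.sr i) = s * r ^ i.val := rfl
  have hinj : Function.Injective f := by
    rw [injective_iff_map_eq_one]
    rintro (i | i) hi
    · rw [hf1] at hi
      have h1 := orderOf_dvd_of_pow_eq_one hi
      rw [hr] at h1
      have := Nat.eq_zero_of_dvd_of_lt h1 (ZMod.val_lt i)
      rw [(ZMod.val_eq_zero i).1 this]; rfl
    · rw [hf2] at hi
      refine absurd ?_ hns
      rw [eq_inv_of_mul_eq_one_left hi]
      exact inv_mem (pow_mem (Subgroup.mem_zpowers r) _)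
  have hz (x : Q) (hx : x ∈ Subgroup.zpowers r) : ∃ i : ZMod m, x = r ^ i.val := by
    have hfin : IsOfFinOrder r := by
      rw [← orderOf_pos_iff, hr]; exact Nat.pos_of_ne_zero (NeZero.ne m)
    obtain ⟨k, hk⟩ := (hfin.mem_powers_iff_mem_zpowers).2 hx
    refine ⟨(k : ZMod m), ?_⟩
    rw [← hk, ZMod.val_natCast]
    change r ^ k = _
    rw [← hr, pow_mod_orderOf]
  have hrange : f.range = K := by
    ext x
    constructor
    · rintro ⟨i | i, rfl⟩
      · exact pow_mem hrK _
      · exact mul_mem hsK (pow_mem hrK _)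
    · intro hx
      rcases hK x hx with h | h
      · obtain ⟨i, hi⟩ := hz x h
        exact ⟨.r i, hi.symm⟩
      · obtain ⟨i, hi⟩ := hz _ h
        refine ⟨.sr i, ?_⟩
        rw [hf2, ← hi, ← mul_assoc, hs, one_mul]
  exact hrange ▸ ⟨(MonoidHom.ofInjective hinj).symm⟩

end Dihedral

section StandardGroups

variable {ℓ : ℕ}

/-- The subgroup generated by the diagonal matrices with entries in `H` and an
antidiagonal matrix. -/
def grp (H : Subgroup ((ZMod ℓ)ˣ × (ZMod ℓ)ˣ)) (t : (ZMod ℓ)ˣ) : Subgroup (GL2 ℓ) :=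
  Subgroup.closure (dg '' H ∪ {ad 1 t})

/-- Swap-invariant subgroups of pairs of units whose scalars are the `d`-th roots of unity
and whose group of ratios is cyclic of order `m`. -/
structure IsStd (d m : ℕ) (H : Subgroup ((ZMod ℓ)ˣ × (ZMod ℓ)ˣ)) : Prop where
  swap : ∀ x ∈ H, x.swap ∈ H
  scal : ∀ z, (z, z) ∈ H ↔ z ^ d = 1
  ratio : ∀ x ∈ H, (x.1 / x.2) ^ m = 1
  gen : ∃ x ∈ H, orderOf (x.1 / x.2) = m

lemma mem_grp {H : Subgroup ((ZMod ℓ)ˣ × (ZMod ℓ)ˣ)} {t : (ZMod ℓ)ˣ}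
    (hs : ∀ x ∈ H, x.swap ∈ H) (ht : (t, t) ∈ H) (g : GL2 ℓ) :
    g ∈ grp H t ↔ (∃ x ∈ H, g = dg x) ∨ ∃ x ∈ H, g = ad x.1 (x.2 * t) := by
  let K : Subgroup (GL2 ℓ) :=
    { carrier := {g | (∃ x ∈ H, g = dg x) ∨ ∃ x ∈ H, g = ad x.1 (x.2 * t)}
      one_mem' := Or.inl ⟨1, one_mem H, (map_one dg).symm⟩
      mul_mem' := by
        rintro _ _ (⟨x, hx, rfl⟩ | ⟨x, hx, rfl⟩) (⟨y, hy, rfl⟩ | ⟨y, hy, rfl⟩)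
        · exact Or.inl ⟨x * y, mul_mem hx hy, (map_mul dg x y).symm⟩
        · exact Or.inr ⟨x * y, mul_mem hx hy, by
            rw [dg_mul_ad, Prod.fst_mul, Prod.snd_mul, mul_assoc]⟩
        · refine Or.inr ⟨x * y.swap, mul_mem hx (hs y hy), ?_⟩
          rw [ad_mul_dg]; simp [mul_right_comm]
        · refine Or.inl ⟨x * y.swap * (t, t), mul_mem (mul_mem hx (hs y hy)) ht, ?_⟩
          rw [ad_mul_ad]
          congr 1
          ext1 <;> simp [mul_left_comm, mul_comm]
      inv_mem' := by
        rintro _ (⟨x, hx, rfl⟩ | ⟨x, hx, rfl⟩)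
        · exact Or.inl ⟨x⁻¹, inv_mem hx, (map_inv dg x).symm⟩
        · refine Or.inr ⟨x.swap⁻¹ * (t, t)⁻¹, mul_mem (inv_mem (hs x hx)) (inv_mem ht), ?_⟩
          rw [ad_inv]; simp [mul_comm] }
  have hK : grp H t = K := by
    apply le_antisymm
    · rw [grp, Subgroup.closure_le]
      rintro _ (⟨x, hx, rfl⟩ | rfl)
      · exact Or.inl ⟨x, hx, rfl⟩
      · exact Or.inr ⟨1, one_mem H, by simp⟩
    · rintro _ (⟨x, hx, rfl⟩ | ⟨x, hx, rfl⟩)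
      · exact Subgroup.subset_closure (Or.inl ⟨x, hx, rfl⟩)
      · have : ad x.1 (x.2 * t) = dg x * ad 1 t := by rw [dg_mul_ad, mul_one]
        rw [this]
        exact mul_mem (Subgroup.subset_closure (Or.inl ⟨x, hx, rfl⟩))
          (Subgroup.subset_closure (Or.inr rfl))
  rw [hK]; rfl

/-- The projection to the projective linear group. -/
abbrev pj (ℓ : ℕ) : GL2 ℓ →* GL2 ℓ ⧸ Subgroup.center (GL2 ℓ) :=
  QuotientGroup.mk' (Subgroup.center (GL2 ℓ))

lemma pj_eq_one_iff (g : GL2 ℓ) : pj ℓ g = 1 ↔ g ∈ Subgroup.center (GL2 ℓ) :=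
  QuotientGroup.eq_one_iff g

variable [Fact ℓ.Prime]

lemma dg_mem_grp {H : Subgroup ((ZMod ℓ)ˣ × (ZMod ℓ)ˣ)} {t : (ZMod ℓ)ˣ}
    (hs : ∀ x ∈ H, x.swap ∈ H) (ht : (t, t) ∈ H) (x : (ZMod ℓ)ˣ × (ZMod ℓ)ˣ) :
    dg x ∈ grp H t ↔ x ∈ H := by
  rw [mem_grp hs ht]
  constructor
  · rintro (⟨y, hy, h⟩ | ⟨y, -, h⟩)
    · rwa [dg_injective h]
    · exact absurd h (dg_ne_ad _ _ _)
  · exact fun h => Or.inl ⟨x, h, rfl⟩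

lemma ad_mem_grp {H : Subgroup ((ZMod ℓ)ˣ × (ZMod ℓ)ˣ)} {t : (ZMod ℓ)ˣ}
    (hs : ∀ x ∈ H, x.swap ∈ H) (ht : (t, t) ∈ H) (p q : (ZMod ℓ)ˣ) :
    ad p q ∈ grp H t ↔ (p, q / t) ∈ H := by
  rw [mem_grp hs ht]
  constructor
  · rintro (⟨y, -, h⟩ | ⟨y, hy, h⟩)
    · exact absurd h.symm (dg_ne_ad _ _ _)
    · obtain ⟨rfl, rfl⟩ := ad_injective h
      simpa using hy
  · exact fun h => Or.inr ⟨_, h, by simp⟩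

lemma pj_dg_mem_zpowers {x y : (ZMod ℓ)ˣ × (ZMod ℓ)ˣ}
    (h : x.1 / x.2 ∈ Subgroup.zpowers (y.1 / y.2)) :
    pj ℓ (dg x) ∈ Subgroup.zpowers (pj ℓ (dg y)) := by
  obtain ⟨k, hk⟩ := h
  refine ⟨k, ?_⟩
  change pj ℓ (dg y) ^ k = _
  rw [← map_zpow, ← map_zpow, ← mul_inv_eq_one, ← map_inv, ← map_inv, ← map_mul, ← map_mul,
    pj_eq_one_iff, dg_mem_center_iff]
  change (y.1 / y.2) ^ k = _ at hk
  rw [div_zpow, div_eq_div_iff_mul_eq_mul, mul_comm x.1] at hk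
  change y.1 ^ k * x.1⁻¹ = y.2 ^ k * x.2⁻¹
  rwa [← div_eq_mul_inv, ← div_eq_mul_inv, div_eq_div_iff_mul_eq_mul]

lemma IsStd.mem_zpowers {d m : ℕ} {H : Subgroup ((ZMod ℓ)ˣ × (ZMod ℓ)ˣ)} (h : IsStd d m H)
    {x y : (ZMod ℓ)ˣ × (ZMod ℓ)ˣ} (hy : orderOf (y.1 / y.2) = m) (hx : x ∈ H) :
    x.1 / x.2 ∈ Subgroup.zpowers (y.1 / y.2) := by
  rw [mem_iff_pow_card, Nat.card_zpowers, hy]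
  exact h.ratio x hx

lemma IsStd.nonempty_mulEquiv {d m : ℕ} [NeZero m] {H : Subgroup ((ZMod ℓ)ˣ × (ZMod ℓ)ˣ)}
    (h : IsStd d m H) {t : (ZMod ℓ)ˣ} (ht : t ^ d = 1) :
    Nonempty (projImage (grp H t) ≃* DihedralGroup m) := by
  obtain ⟨y, hyH, hy⟩ := h.gen
  have htH := (h.scal t).2 ht
  have hs2 : pj ℓ (ad 1 t) * pj ℓ (ad 1 t) = 1 := by
    rw [← map_mul, pj_eq_one_iff, ad_mul_ad, dg_mem_center_iff]; simp
  have had : ad 1 t ∈ grp H t := Subgroup.subset_closure (Or.inr rfl)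
  refine nonempty_mulEquiv_dihedralGroup_s10 _ (pj ℓ (dg y)) (pj ℓ (ad 1 t)) m ?_ hs2 ?_ ?_ ?_ ?_ ?_
  · rw [← hy]
    refine orderOf_eq_orderOf_iff.2 fun k => ?_
    rw [← map_pow, ← map_pow, pj_eq_one_iff, dg_mem_center_iff, div_pow, div_eq_one]
    rfl
  · rw [eq_inv_iff_mul_eq_one, ← map_mul, ← map_mul, ← map_mul, pj_eq_one_iff, ad_mul_dg,
      ad_mul_ad, ← map_mul, dg_mem_center_iff]
    simp [mul_comm, mul_left_comm]
  · rintro ⟨k, hk⟩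
    change pj ℓ (dg y) ^ k = _ at hk
    rw [← map_zpow, ← map_zpow, eq_comm, ← mul_inv_eq_one, ← map_inv, ← map_mul, pj_eq_one_iff,
      ← map_inv, ad_mul_dg] at hk
    exact ad_not_mem_center _ _ hk
  · exact ⟨_, (dg_mem_grp h.swap htH y).2 hyH, rfl⟩
  · exact ⟨_, had, rfl⟩
  · rintro _ ⟨g, hg, rfl⟩
    rcases (mem_grp h.swap htH g).1 hg with ⟨x, hx, rfl⟩ | ⟨x, hx, rfl⟩
    · exact Or.inl (pj_dg_mem_zpowers (h.mem_zpowers hy hx))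
    · right
      change pj ℓ (ad 1 t) * pj ℓ _ ∈ _
      rw [← map_mul, ad_mul_ad]
      exact pj_dg_mem_zpowers (h.mem_zpowers hy
        (by
          have := mul_mem (h.swap x hx) htH
          rw [mul_comm] at this
          rwa [one_mul, mul_comm x.2 t]))

lemma IsStd.card_projImage {d m : ℕ} [NeZero m] {H : Subgroup ((ZMod ℓ)ˣ × (ZMod ℓ)ˣ)}
    (h : IsStd d m H) {t : (ZMod ℓ)ˣ} (ht : t ^ d = 1) :
    Nat.card (projImage (grp H t)) = 2 * m := by
  obtain ⟨e⟩ := h.nonempty_mulEquiv ht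
  rw [Nat.card_congr e.toEquiv, DihedralGroup.nat_card]

end StandardGroups

section Conjugacy

/-- Conjugacy of subgroups. -/
def AreConj {G : Type*} [Group G] (A B : Subgroup G) : Prop := ∃ c, ∀ x, x ∈ A ↔ c * x * c⁻¹ ∈ B

lemma AreConj.symm {G : Type*} [Group G] {A B : Subgroup G} (h : AreConj A B) : AreConj B A := by
  obtain ⟨c, hc⟩ := h
  exact ⟨c⁻¹, fun x => by rw [hc]; group⟩

lemma AreConj.trans {G : Type*} [Group G] {A B C : Subgroup G} (h : AreConj A B)
    (h' : AreConj B C) : AreConj A C := by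
  obtain ⟨c, hc⟩ := h
  obtain ⟨c', hc'⟩ := h'
  exact ⟨c' * c, fun x => by rw [hc, hc']; group⟩

lemma areConj_iff_orbitRel {G : Type*} [Group G] (A B : Subgroup G) :
    AreConj A B ↔ MulAction.orbitRel (ConjAct G) (Subgroup G) A B := by
  rw [MulAction.orbitRel_apply, MulAction.mem_orbit_iff]
  constructor
  · rintro ⟨c, hc⟩
    refine ⟨ConjAct.toConjAct c⁻¹, ?_⟩
    ext x
    rw [Subgroup.mem_pointwise_smul_iff_inv_smul_mem, ← ConjAct.toConjAct_inv,
      ConjAct.toConjAct_smul, hc, inv_inv]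
  · rintro ⟨c, rfl⟩
    refine ⟨(ConjAct.ofConjAct c)⁻¹, fun x => ?_⟩
    rw [Subgroup.mem_pointwise_smul_iff_inv_smul_mem, ConjAct.smul_def, ConjAct.ofConjAct_inv]

variable {ℓ : ℕ}

lemma AreConj.nonempty_projImage {A B : Subgroup (GL2 ℓ)} (h : AreConj A B) :
    Nonempty (projImage A ≃* projImage B) := by
  obtain ⟨c, hc⟩ := h
  have hB : projImage B = (projImage A).map (MulAut.conj (pj ℓ c)).toMonoidHom := by
    ext y
    constructor
    · rintro ⟨b, hb, rfl⟩
      refine ⟨pj ℓ (c⁻¹ * b * c), ⟨_, (hc _).2 (by simpa [mul_assoc] using hb), rfl⟩, ?_⟩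
      simp [mul_assoc]
    · rintro ⟨_, ⟨a, ha, rfl⟩, rfl⟩
      exact ⟨c * a * c⁻¹, (hc a).1 ha, by simp⟩
  rw [hB]
  exact ⟨(projImage A).equivMapOfInjective _ (MulAut.conj (pj ℓ c)).injective⟩

lemma AreConj.isDihedralProj {A B : Subgroup (GL2 ℓ)} (h : AreConj A B)
    (hB : IsDihedralProj B) : IsDihedralProj A := by
  obtain ⟨m, hm, ⟨e⟩⟩ := hB
  obtain ⟨f⟩ := h.nonempty_projImage
  exact ⟨m, hm, ⟨f.trans e⟩⟩

lemma AreConj.dg_mem_iff [Fact ℓ.Prime] {A B : Subgroup (GL2 ℓ)} (h : AreConj A B)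
    (z : (ZMod ℓ)ˣ) : dg (z, z) ∈ A ↔ dg (z, z) ∈ B := by
  obtain ⟨c, hc⟩ := h
  have := Subgroup.mem_center_iff.1 ((mem_center_GL2_iff _).2 ⟨z, rfl⟩) c
  rw [hc, this, mul_inv_cancel_right]

end Conjugacy

section Structure

variable {ℓ : ℕ}

lemma IsDihedralProj.not_isCyclic {G : Subgroup (GL2 ℓ)} (h : IsDihedralProj G) :
    ¬ IsCyclic (projImage G) := by
  obtain ⟨m, hm, ⟨e⟩⟩ := h
  intro hc
  exact DihedralGroup.not_isCyclic (n := m) (by omega)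
    (isCyclic_of_surjective e e.surjective)

variable [Fact ℓ.Prime]

lemma exists_isStd {G : Subgroup (GL2 ℓ)} (hG : ∀ x ∈ G, IsCsPlusElt x)
    (hD : IsDihedralProj G) : ∃ d m, d ∣ ℓ - 1 ∧ m ∣ ℓ - 1 ∧ 2 ≤ m ∧
      IsStd d m (G.comap dg) ∧ ∃ p q, ad p q ∈ G := by
  have hnc := hD.not_isCyclic
  have hcardU : Nat.card (ZMod ℓ)ˣ = ℓ - 1 := by
    rw [Nat.card_eq_fintype_card, ZMod.card_units]
  have hb : ∃ p q, ad p q ∈ G := by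
    by_contra! hb
    let θ : (ZMod ℓ)ˣ →* GL2 ℓ ⧸ Subgroup.center (GL2 ℓ) :=
      (pj ℓ).comp (dg.comp (MonoidHom.inl _ _))
    have hθ : IsCyclic θ.range := isCyclic_of_surjective θ.rangeRestrict θ.rangeRestrict_surjective
    refine hnc (Subgroup.isCyclic_of_le (H' := θ.range) ?_)
    rintro _ ⟨g, hg, rfl⟩
    rcases (isCsPlusElt_iff g).1 (hG g hg) with ⟨x, rfl⟩ | ⟨p, q, rfl⟩
    · refine ⟨x.1 / x.2, ?_⟩
      change pj ℓ (dg (x.1 / x.2, 1)) = pj ℓ (dg x)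
      rw [← mul_inv_eq_one, ← map_inv, ← map_inv, ← map_mul, ← map_mul, pj_eq_one_iff,
        dg_mem_center_iff]
      simp [div_eq_mul_inv]
    · exact absurd hg (hb p q)
  let D : Subgroup (ZMod ℓ)ˣ := G.comap (dg.comp ((MonoidHom.id _).prod (MonoidHom.id _)))
  let R : Subgroup (ZMod ℓ)ˣ := (G.comap dg).map divMonoidHom
  have hR {x} (hx : x ∈ G.comap dg) : x.1 / x.2 ∈ R := ⟨x, hx, rfl⟩
  obtain ⟨p, q, hpq⟩ := hb
  have hm : 2 ≤ Nat.card R := by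
    by_contra hlt
    have hbot : R = ⊥ := by
      apply Subgroup.eq_bot_of_card_le; omega
    apply hnc
    refine Subgroup.isCyclic_of_le (H' := Subgroup.zpowers (pj ℓ (ad p q))) ?_
    rintro _ ⟨g, hg, rfl⟩
    rcases (isCsPlusElt_iff g).1 (hG g hg) with ⟨x, rfl⟩ | ⟨r, s, rfl⟩
    · have h1 := hR hg
      rw [hbot, Subgroup.mem_bot, div_eq_one, ← dg_mem_center_iff, ← pj_eq_one_iff] at h1
      rw [h1]; exact one_mem _
    · have h1 := mul_mem hg (inv_mem hpq)
      rw [ad_inv, ad_mul_ad] at h1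
      have h1 := hR (x := (_, _)) h1
      rw [hbot, Subgroup.mem_bot, div_eq_one, ← dg_mem_center_iff, ← pj_eq_one_iff, ← ad_mul_ad,
        ← ad_inv, map_mul, map_inv, mul_inv_eq_one] at h1
      rw [h1]; exact Subgroup.mem_zpowers _
  refine ⟨Nat.card D, Nat.card R, hcardU ▸ D.card_subgroup_dvd_card,
    hcardU ▸ R.card_subgroup_dvd_card, hm, ⟨?_, ?_, ?_, ?_⟩, p, q, hpq⟩
  · intro x hx
    have h1 := mul_mem (mul_mem hpq hx) (inv_mem hpq)
    rw [ad_mul_dg, ad_inv, ad_mul_ad] at h1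
    rwa [mul_right_comm, mul_inv_cancel, one_mul, mul_right_comm, mul_inv_cancel, one_mul] at h1
  · intro z
    rw [← mem_iff_pow_card]; rfl
  · intro x hx
    rw [← mem_iff_pow_card]
    exact hR hx
  · obtain ⟨⟨g, x, hx, hxg⟩, hg⟩ := IsCyclic.exists_ofOrder_eq_natCard (α := R)
    refine ⟨x, hx, ?_⟩
    rw [← hg, ← Subgroup.orderOf_coe]
    exact congrArg orderOf hxg

lemma areConj_grp {G : Subgroup (GL2 ℓ)} (hG : ∀ x ∈ G, IsCsPlusElt x)
    (hs : ∀ x ∈ G.comap dg, x.swap ∈ G.comap dg) {p q : (ZMod ℓ)ˣ} (hpq : ad p q ∈ G) :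
    (p * q, p * q) ∈ G.comap dg ∧ AreConj G (grp (G.comap dg) (p * q)) := by
  have ht : (p * q, p * q) ∈ G.comap dg := by
    have := mul_mem hpq hpq
    rw [ad_mul_ad, mul_comm q p] at this
    exact this
  refine ⟨ht, dg (p⁻¹, 1), fun x => ?_⟩
  have hinv : (dg (p⁻¹, 1))⁻¹ = dg (p, 1) := by rw [← map_inv]; simp
  have hdg (y : (ZMod ℓ)ˣ × (ZMod ℓ)ˣ) : dg (p⁻¹, 1) * dg y * dg (p, 1) = dg y := by
    rw [← map_mul, ← map_mul]; congr 1; ext1 <;> simp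
  have had (r s : (ZMod ℓ)ˣ) : dg (p⁻¹, 1) * ad r s * dg (p, 1) = ad (p⁻¹ * r) (p * s) := by
    rw [dg_mul_ad, ad_mul_dg]; simp [mul_comm]
  have key (r s : (ZMod ℓ)ˣ) : (p⁻¹ * r, p * s / (p * q)) ∈ G.comap dg ↔ ad r s ∈ G := by
    have : ad r s = dg (p⁻¹ * r, p * s / (p * q)) * ad p q := by
      rw [dg_mul_ad, mul_right_comm, inv_mul_cancel, one_mul,
        mul_div_mul_left_eq_div, div_mul_cancel]
    rw [this]
    exact (Subgroup.mul_mem_cancel_right G hpq).symm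
  rw [hinv]
  constructor
  · intro hx
    rcases (isCsPlusElt_iff x).1 (hG x hx) with ⟨y, rfl⟩ | ⟨r, s, rfl⟩
    · rw [hdg, dg_mem_grp hs ht]; exact hx
    · rw [had, ad_mem_grp hs ht, key]; exact hx
  · intro hx
    rcases (mem_grp hs ht _).1 hx with ⟨y, hy, h⟩ | ⟨y, hy, h⟩
    · rw [← hdg y] at h
      rw [mul_left_cancel (mul_right_cancel h)]
      exact hy
    · have hr := had (p * y.1) (p⁻¹ * (y.2 * (p * q)))
      rw [inv_mul_cancel_left, mul_inv_cancel_left] at hr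
      rw [← hr] at h
      rw [mul_left_cancel (mul_right_cancel h), ← key, inv_mul_cancel_left, mul_inv_cancel_left,
        mul_div_cancel_right]
      exact hy

end Structure

section StandardDiagonal

variable {ℓ : ℕ}

/-- The homomorphism `(p, q) ↦ (p * q) ^ k`. -/
def prodPow (k : ℕ) : (ZMod ℓ)ˣ × (ZMod ℓ)ˣ →* (ZMod ℓ)ˣ := (powMonoidHom k).comp mulMonoidHom

/-- The homomorphism `(p, q) ↦ (p / q) ^ k`. -/
def ratioPow (k : ℕ) : (ZMod ℓ)ˣ × (ZMod ℓ)ˣ →* (ZMod ℓ)ˣ := (powMonoidHom k).comp divMonoidHom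

lemma prodPow_apply (k : ℕ) (x : (ZMod ℓ)ˣ × (ZMod ℓ)ˣ) : prodPow k x = (x.1 * x.2) ^ k := rfl

lemma ratioPow_apply (k : ℕ) (x : (ZMod ℓ)ˣ × (ZMod ℓ)ˣ) : ratioPow k x = (x.1 / x.2) ^ k := rfl

/-- The standard diagonal group with `d` and `m` odd. -/
def oddH (ℓ d m : ℕ) : Subgroup ((ZMod ℓ)ˣ × (ZMod ℓ)ˣ) :=
  ((powMonoidHom (d * m)).comp (MonoidHom.fst _ _)).ker ⊓ (prodPow d).ker ⊓ (ratioPow m).ker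

/-- The standard diagonal group all of whose determinants are squares of scalars. -/
def sqH (ℓ d m : ℕ) : Subgroup ((ZMod ℓ)ˣ × (ZMod ℓ)ˣ) :=
  (prodPow (d / 2)).ker ⊓ (ratioPow m).ker

/-- The standard diagonal group, with `d` even, having determinants that are not squares
of scalars. -/
def nsqH (ℓ d m : ℕ) : Subgroup ((ZMod ℓ)ˣ × (ZMod ℓ)ˣ) :=
  (prodPow (d / 2)).eqLocus (ratioPow (m / 2)) ⊓ (ratioPow m).ker

lemma mem_oddH {d m : ℕ} {x : (ZMod ℓ)ˣ × (ZMod ℓ)ˣ} :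
    x ∈ oddH ℓ d m ↔ (x.1 ^ (d * m) = 1 ∧ (x.1 * x.2) ^ d = 1) ∧ (x.1 / x.2) ^ m = 1 := Iff.rfl

lemma mem_sqH {d m : ℕ} {x : (ZMod ℓ)ˣ × (ZMod ℓ)ˣ} :
    x ∈ sqH ℓ d m ↔ (x.1 * x.2) ^ (d / 2) = 1 ∧ (x.1 / x.2) ^ m = 1 := Iff.rfl

lemma mem_nsqH {d m : ℕ} {x : (ZMod ℓ)ˣ × (ZMod ℓ)ˣ} :
    x ∈ nsqH ℓ d m ↔ (x.1 * x.2) ^ (d / 2) = (x.1 / x.2) ^ (m / 2) ∧ (x.1 / x.2) ^ m = 1 := Iff.rfl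

lemma swap_ratio_pow {m : ℕ} {x : (ZMod ℓ)ˣ × (ZMod ℓ)ˣ} (h : (x.1 / x.2) ^ m = 1) :
    (x.2 / x.1) ^ m = 1 := by
  rw [← inv_div, inv_pow, h, inv_one]

lemma mul_self_pow_half {d : ℕ} (hd : 2 ∣ d) (z : (ZMod ℓ)ˣ) : (z * z) ^ (d / 2) = z ^ d := by
  rw [← sq, ← pow_mul, Nat.mul_div_cancel' hd]

lemma even_of_neg_one_pow [Fact ℓ.Prime] (hodd : Odd ℓ) {k : ℕ}
    (h : (-1 : (ZMod ℓ)ˣ) ^ k = 1) : Even k := by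
  rcases Nat.even_or_odd k with hk | hk
  · exact hk
  · rw [hk.neg_one_pow] at h
    exact absurd h (neg_one_ne_one_units hodd)

lemma eq_one_of_odd {d : ℕ} (hd : Odd d) {z : (ZMod ℓ)ˣ} (h2 : z ^ 2 = 1) (h : z ^ d = 1) :
    z = 1 := by
  have := (Nat.coprime_two_left.2 hd)
  have h1 := Nat.dvd_gcd (orderOf_dvd_of_pow_eq_one h2) (orderOf_dvd_of_pow_eq_one h)
  rw [this.gcd_eq_one] at h1
  exact orderOf_eq_one_iff.1 (Nat.dvd_one.1 h1)

variable [Fact ℓ.Prime]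

lemma isStd_oddH {d m : ℕ} (hm : Odd m) (hmn : m ∣ ℓ - 1) :
    IsStd d m (oddH ℓ d m) := by
  refine ⟨?_, ?_, fun x hx => (mem_oddH.1 hx).2, ?_⟩
  · intro x hx
    obtain ⟨⟨h1, h2⟩, h3⟩ := mem_oddH.1 hx
    refine mem_oddH.2 ⟨⟨?_, by rw [mul_comm]; exact h2⟩, swap_ratio_pow h3⟩
    rw [div_pow, div_eq_one] at h3
    change x.2 ^ (d * m) = 1
    rw [mul_comm, pow_mul, ← h3, ← pow_mul, mul_comm, h1]
  · intro z
    rw [mem_oddH]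
    constructor
    · rintro ⟨⟨h1, h2⟩, -⟩
      refine eq_one_of_odd hm ?_ (by rw [← pow_mul]; exact h1)
      rw [← pow_mul, mul_comm, pow_mul, sq]; exact h2
    · intro h
      exact ⟨⟨by rw [pow_mul, h, one_pow], by rw [mul_pow, h, one_mul]⟩, by rw [div_self', one_pow]⟩
  · obtain ⟨ρ, hρ⟩ := exists_orderOf_eq (ℓ := ℓ) hmn
    obtain ⟨k, hk⟩ := hm
    have h1 : ρ ^ (k + 1) / (ρ ^ (k + 1))⁻¹ = ρ := by
      rw [div_inv_eq_mul, ← pow_add, show k + 1 + (k + 1) = m + 1 by omega, pow_succ, ← hρ,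
        pow_orderOf_eq_one, one_mul]
    refine ⟨(ρ ^ (k + 1), (ρ ^ (k + 1))⁻¹), mem_oddH.2 ⟨⟨?_, ?_⟩, ?_⟩, ?_⟩
    · rw [← pow_mul, show (k + 1) * (d * m) = m * ((k + 1) * d) by ring, pow_mul,
        show ρ ^ m = 1 from hρ ▸ pow_orderOf_eq_one ρ, one_pow]
    · simp
    · change (ρ ^ (k + 1) / (ρ ^ (k + 1))⁻¹) ^ m = 1
      rw [h1, ← hρ, pow_orderOf_eq_one]
    · exact (congrArg orderOf h1).trans hρ

lemma isStd_sqH (hodd : Odd ℓ) {d m : ℕ} (hd : 2 ∣ d) (hmn : 2 * m ∣ ℓ - 1) :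
    IsStd d m (sqH ℓ d m) := by
  refine ⟨?_, ?_, fun x hx => (mem_sqH.1 hx).2, ?_⟩
  · intro x hx
    obtain ⟨h2, h3⟩ := mem_sqH.1 hx
    exact mem_sqH.2 ⟨by rw [mul_comm]; exact h2, swap_ratio_pow h3⟩
  · intro z
    rw [mem_sqH, mul_self_pow_half hd]
    simp
  · obtain ⟨ρ, hρ⟩ := exists_orderOf_eq (ℓ := ℓ) (dvd_of_mul_left_dvd hmn)
    obtain ⟨v, hv⟩ := (isSquare_unit_iff hodd ρ).2 (by
      rw [← orderOf_dvd_iff_pow_eq_one, hρ]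
      exact Nat.dvd_div_of_mul_dvd hmn)
    have h1 : v / v⁻¹ = ρ := by rw [div_inv_eq_mul, ← sq, hv]
    refine ⟨(v, v⁻¹), mem_sqH.2 ⟨by simp, ?_⟩, (congrArg orderOf h1).trans hρ⟩
    change (v / v⁻¹) ^ m = 1
    rw [h1, ← hρ, pow_orderOf_eq_one]

/-- A unit that is not a square in the group of `d`-th roots of unity, if there is one. -/
noncomputable def zeta (ℓ d : ℕ) : (ZMod ℓ)ˣ :=
  open Classical in if h : ∃ z : (ZMod ℓ)ˣ, z ^ (d / 2) = -1 then h.choose else 1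

lemma zeta_pow_half {d : ℕ} (hd : 2 ∣ d) (hdn : d ∣ ℓ - 1) : zeta ℓ d ^ (d / 2) = -1 := by
  have h : ∃ z : (ZMod ℓ)ˣ, z ^ (d / 2) = -1 := by
    obtain ⟨z, rfl⟩ := exists_orderOf_eq (ℓ := ℓ) hdn
    exact ⟨z, pow_half_orderOf hd⟩
  rw [zeta, dif_pos h]
  exact h.choose_spec

lemma pow_eq_one_of_half {d : ℕ} (hd : 2 ∣ d) {z : (ZMod ℓ)ˣ}
    (h : z ^ (d / 2) = 1 ∨ z ^ (d / 2) = -1) : z ^ d = 1 := by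
  rw [← Nat.div_mul_cancel hd, pow_mul]
  rcases h with h | h <;> simp [h]

lemma pow_half_eq {d : ℕ} (hd : 2 ∣ d) {z : (ZMod ℓ)ˣ} (h : z ^ d = 1) :
    z ^ (d / 2) = 1 ∨ z ^ (d / 2) = -1 := by
  rw [← Nat.div_mul_cancel hd, pow_mul] at h
  exact unit_eq_one_or_neg_one h

lemma pow_half_card {d : ℕ} (hd : 2 ∣ d) (hdn : d ∣ ℓ - 1) {y : (ZMod ℓ)ˣ}
    (hy : y ^ (d / 2) = -1) : y ^ ((ℓ - 1) / 2) = (-1) ^ ((ℓ - 1) / d) := by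
  obtain ⟨e, rfl⟩ := hd
  obtain ⟨k, hk⟩ := hdn
  have : 0 < 2 * e := Nat.pos_of_ne_zero (by
    rintro h; rw [h] at hk; have := (Fact.out : ℓ.Prime).two_le; omega)
  rw [hk, Nat.mul_div_cancel_left _ this, mul_assoc, Nat.mul_div_cancel_left _ two_pos, pow_mul]
  rw [Nat.mul_div_cancel_left _ two_pos] at hy
  rw [hy]

lemma exists_mem_nsqH (hodd : Odd ℓ) {d m : ℕ} (hd : 2 ∣ d) (hm : 2 ∣ m) (hdn : d ∣ ℓ - 1)
    (hmn : m ∣ ℓ - 1) (hpar : (ℓ - 1) / d % 2 = (ℓ - 1) / m % 2) :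
    ∃ x ∈ nsqH ℓ d m, orderOf (x.1 / x.2) = m ∧ (x.1 * x.2) ^ (d / 2) = -1 := by
  obtain ⟨ρ, hρ⟩ := exists_orderOf_eq (ℓ := ℓ) hmn
  have hρ' : ρ ^ (m / 2) = -1 := by
    subst hρ; exact pow_half_orderOf hm
  obtain ⟨p, hp⟩ := (isSquare_unit_iff hodd (ρ * zeta ℓ d)).2 (by
    rw [mul_pow, pow_half_card hm hmn hρ', pow_half_card hd hdn (zeta_pow_half hd hdn), ← pow_add]
    exact Even.neg_one_pow (Nat.even_iff.2 (by omega)))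
  have h1 : p / (p / ρ) = ρ := by rw [div_div_cancel]
  have h2 : p * (p / ρ) = zeta ℓ d := by
    rw [← mul_div_assoc, ← sq, hp, mul_div_cancel_left]
  refine ⟨(p, p / ρ), mem_nsqH.2 ⟨?_, ?_⟩, ?_, ?_⟩
  · change (p * (p / ρ)) ^ _ = (p / (p / ρ)) ^ _
    rw [h1, h2, hρ', zeta_pow_half hd hdn]
  · change (p / (p / ρ)) ^ _ = 1
    rw [h1, ← hρ, pow_orderOf_eq_one]
  · exact (congrArg orderOf h1).trans hρ
  · change (p * (p / ρ)) ^ _ = _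
    rw [h2, zeta_pow_half hd hdn]

lemma isStd_nsqH (hodd : Odd ℓ) {d m : ℕ} (hd : 2 ∣ d) (hm : 2 ∣ m) (hdn : d ∣ ℓ - 1)
    (hmn : m ∣ ℓ - 1) (hpar : (ℓ - 1) / d % 2 = (ℓ - 1) / m % 2) :
    IsStd d m (nsqH ℓ d m) := by
  refine ⟨?_, ?_, fun x hx => (mem_nsqH.1 hx).2, ?_⟩
  · intro x hx
    obtain ⟨h2, h3⟩ := mem_nsqH.1 hx
    refine mem_nsqH.2 ⟨?_, swap_ratio_pow h3⟩
    change (x.2 * x.1) ^ _ = (x.2 / x.1) ^ _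
    rw [mul_comm, h2, ← inv_div x.1 x.2, inv_pow]
    rcases pow_half_eq hm h3 with h | h <;> simp [h]
  · intro z
    rw [mem_nsqH, mul_self_pow_half hd]
    simp
  · obtain ⟨x, hx, h, -⟩ := exists_mem_nsqH hodd hd hm hdn hmn hpar
    exact ⟨x, hx, h⟩

lemma exists_eq_scalar_mul_zpow {x y : (ZMod ℓ)ˣ × (ZMod ℓ)ˣ}
    (h : x.1 / x.2 ∈ Subgroup.zpowers (y.1 / y.2)) :
    ∃ (k : ℤ) (s : (ZMod ℓ)ˣ), x = (s, s) * y ^ k := by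
  obtain ⟨k, hk⟩ := h
  change (y.1 / y.2) ^ k = x.1 / x.2 at hk
  refine ⟨k, x.1 / y.1 ^ k, Prod.ext (div_mul_cancel _ _).symm ?_⟩
  rw [div_zpow, div_eq_div_iff_mul_eq_mul] at hk
  change x.2 = x.1 / y.1 ^ k * y.2 ^ k
  rw [div_mul_eq_mul_div, ← hk, mul_div_cancel_left]

lemma IsStd.eq_of_le {d m : ℕ} {H H' : Subgroup ((ZMod ℓ)ˣ × (ZMod ℓ)ˣ)} (h : IsStd d m H)
    (h' : IsStd d m H') (hle : H ≤ H') : H = H' := by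
  refine le_antisymm hle fun x hx => ?_
  obtain ⟨y, hy, hym⟩ := h.gen
  obtain ⟨k, s, rfl⟩ := exists_eq_scalar_mul_zpow (h'.mem_zpowers hym hx)
  rw [Subgroup.mul_mem_cancel_right _ (zpow_mem (hle hy) k), h'.scal, ← h.scal] at hx
  exact mul_mem hx (zpow_mem hy k)

lemma IsStd.prod_pow {d m : ℕ} {H : Subgroup ((ZMod ℓ)ˣ × (ZMod ℓ)ˣ)} (h : IsStd d m H)
    {x : (ZMod ℓ)ˣ × (ZMod ℓ)ˣ} (hx : x ∈ H) : (x.1 * x.2) ^ d = 1 := by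
  rw [← h.scal]
  have := mul_mem hx (h.swap x hx)
  rwa [show x * x.swap = (x.1 * x.2, x.1 * x.2) from Prod.ext rfl (mul_comm _ _)] at this

lemma IsStd.exists_pow_eq {d m : ℕ} {H : Subgroup ((ZMod ℓ)ˣ × (ZMod ℓ)ˣ)} (h : IsStd d m H)
    {x : (ZMod ℓ)ˣ × (ZMod ℓ)ˣ} (hx : x ∈ H) : ∃ s, s ^ d = 1 ∧ x ^ m = (s, s) := by
  have h1 := h.ratio x hx
  rw [div_pow, div_eq_one] at h1
  have h2 : x ^ m = (x.1 ^ m, x.1 ^ m) := Prod.ext rfl h1.symm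
  exact ⟨_, (h.scal _).1 (h2 ▸ pow_mem hx m), h2⟩

lemma IsStd.eq_oddH {d m : ℕ} {H : Subgroup ((ZMod ℓ)ˣ × (ZMod ℓ)ˣ)} (h : IsStd d m H)
    (hd : Odd d) (hm2 : 2 ≤ m) (hmn : m ∣ ℓ - 1) : Odd m ∧ H = oddH ℓ d m := by
  have hm : Odd m := by
    by_contra hm
    rw [Nat.not_odd_iff_even] at hm
    obtain ⟨k, hk⟩ := hm
    obtain ⟨y, hy, hym⟩ := h.gen
    obtain ⟨s, hs, hys⟩ := h.exists_pow_eq hy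
    have h1 : y.1 ^ m = s := congrArg Prod.fst hys
    have h2 : y.2 ^ m = s := congrArg Prod.snd hys
    have h3 : s / (y.1 * y.2) ^ k = 1 := by
      refine eq_one_of_odd hd ?_ ?_
      · rw [div_pow, ← pow_mul, show k * 2 = m by omega, mul_pow, h1, h2, sq, div_self']
      · rw [div_pow, hs, ← pow_mul, mul_comm k, pow_mul, h.prod_pow hy, one_pow, div_self']
    have h4 : (y.1 / y.2) ^ k = 1 := by
      rw [div_eq_one, ← h1, hk, pow_add, mul_pow] at h3
      rw [div_pow, mul_left_cancel h3, div_self']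
    have := Nat.le_of_dvd (by omega) (orderOf_dvd_of_pow_eq_one h4)
    omega
  refine ⟨hm, h.eq_of_le (isStd_oddH hm hmn) fun x hx => ?_⟩
  refine mem_oddH.2 ⟨⟨?_, h.prod_pow hx⟩, h.ratio x hx⟩
  obtain ⟨s, hs, hxs⟩ := h.exists_pow_eq hx
  rw [mul_comm, pow_mul, show x.1 ^ m = s from congrArg Prod.fst hxs, hs]

lemma IsStd.eq_sqH (hodd : Odd ℓ) {d m : ℕ} {H : Subgroup ((ZMod ℓ)ˣ × (ZMod ℓ)ˣ)}
    (h : IsStd d m H) (hd : 2 ∣ d) (hdn : d ∣ ℓ - 1)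
    (hH : ∀ x ∈ H, (x.1 * x.2) ^ (d / 2) = 1) : 2 * m ∣ ℓ - 1 ∧ H = sqH ℓ d m := by
  have hm : 2 * m ∣ ℓ - 1 := by
    obtain ⟨y, hy, hym⟩ := h.gen
    obtain ⟨s, -, hs⟩ := exists_sq_of_pow_half hodd hd hdn (hH y hy)
    have h2 : 2 ∣ ℓ - 1 := hd.trans hdn
    have h1 : y.1 / y.2 = (y.1 / s) ^ 2 := by
      rw [div_pow, hs, sq, mul_div_mul_left_eq_div]
    have h3 : (y.1 / y.2) ^ ((ℓ - 1) / 2) = 1 := by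
      rw [h1, ← pow_mul, Nat.mul_div_cancel' h2, ZMod.units_pow_card_sub_one_eq_one]
    have := orderOf_dvd_of_pow_eq_one h3
    rw [hym] at this
    exact Nat.mul_dvd_of_dvd_div h2 this
  exact ⟨hm, h.eq_of_le (isStd_sqH hodd hd hm) fun x hx => mem_sqH.2 ⟨hH x hx, h.ratio x hx⟩⟩

lemma IsStd.eq_nsqH (hodd : Odd ℓ) {d m : ℕ} {H : Subgroup ((ZMod ℓ)ˣ × (ZMod ℓ)ˣ)}
    (h : IsStd d m H) (hd : 2 ∣ d) (hdn : d ∣ ℓ - 1) (hm2 : 2 ≤ m) (hmn : m ∣ ℓ - 1)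
    (hH : ¬ ∀ x ∈ H, (x.1 * x.2) ^ (d / 2) = 1) :
    2 ∣ m ∧ (ℓ - 1) / d % 2 = (ℓ - 1) / m % 2 ∧ H = nsqH ℓ d m := by
  obtain ⟨y, hy, hym⟩ := h.gen
  have hpow {x} (hx : x ∈ H) : ∃ (k : ℤ) (s : (ZMod ℓ)ˣ), s ^ d = 1 ∧ x = (s, s) * y ^ k := by
    obtain ⟨k, s, rfl⟩ := exists_eq_scalar_mul_zpow (h.mem_zpowers hym hx)
    rw [Subgroup.mul_mem_cancel_right _ (zpow_mem hy k), h.scal] at hx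
    exact ⟨k, s, hx, rfl⟩
  have hχ {s : (ZMod ℓ)ˣ} (hs : s ^ d = 1) : prodPow (d / 2) (s, s) = 1 := by
    rw [prodPow_apply, mul_self_pow_half hd, hs]
  have hψ (s : (ZMod ℓ)ˣ) : ratioPow (m / 2) (s, s) = 1 := by
    rw [ratioPow_apply, div_self', one_pow]
  have hy1 : prodPow (d / 2) y = -1 := by
    refine (pow_half_eq hd (h.prod_pow hy)).resolve_left fun h1 => hH fun x hx => ?_
    obtain ⟨k, s, hs, rfl⟩ := hpow hx
    change prodPow (d / 2) _ = 1
    rw [map_mul, map_zpow, hχ hs, prodPow_apply, h1, _root_.one_zpow, one_mul]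
  have hm : 2 ∣ m := by
    obtain ⟨s, hs, hys⟩ := h.exists_pow_eq hy
    have h1 := congrArg (prodPow (d / 2)) hys
    rw [map_pow, hy1, hχ hs] at h1
    exact (even_of_neg_one_pow hodd h1).two_dvd
  have hy2 : ratioPow (m / 2) y = -1 := by
    subst hym; exact pow_half_orderOf hm
  have hpar : (ℓ - 1) / d % 2 = (ℓ - 1) / m % 2 := by
    have h1 := pow_half_card hd hdn hy1
    have h2 := pow_half_card hm hmn hy2
    have h3 : (-1 : (ZMod ℓ)ˣ) ^ ((ℓ - 1) / d + (ℓ - 1) / m) = 1 := by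
      rw [pow_add]
      erw [← h1, ← h2]
      change (y.1 * y.2) ^ _ * (y.1 / y.2) ^ _ = 1
      rw [← mul_pow, mul_mul_div_cancel, mul_self_pow_half (hd.trans hdn),
        ZMod.units_pow_card_sub_one_eq_one]
    have := Nat.even_iff.1 (even_of_neg_one_pow hodd h3)
    omega
  refine ⟨hm, hpar, h.eq_of_le (isStd_nsqH hodd hd hm hdn hmn hpar) fun x hx => ?_⟩
  refine mem_nsqH.2 ⟨?_, h.ratio x hx⟩
  obtain ⟨k, s, hs, rfl⟩ := hpow hx
  change prodPow (d / 2) _ = ratioPow (m / 2) _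
  rw [map_mul, map_mul, map_zpow, map_zpow, hχ hs, hψ, hy1, hy2]

end StandardDiagonal

section Classification

variable {ℓ : ℕ}

/-- The diagonal part of the standard group of type `k`. -/
def stdH (ℓ d m : ℕ) (k : Fin 4) : Subgroup ((ZMod ℓ)ˣ × (ZMod ℓ)ˣ) :=
  ![oddH ℓ d m, sqH ℓ d m, sqH ℓ d m, nsqH ℓ d m] k

/-- The antidiagonal parameter of the standard group of type `k`. -/
noncomputable def stdT (ℓ d : ℕ) (k : Fin 4) : (ZMod ℓ)ˣ := ![1, -1, -zeta ℓ d, -1] k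

/-- The standard subgroup with parameters `d`, `m` of type `k`. -/
noncomputable def stdG (ℓ d m : ℕ) (k : Fin 4) : Subgroup (GL2 ℓ) := grp (stdH ℓ d m k) (stdT ℓ d k)

/-- The condition on `d` and `m` for the standard group of type `k` to exist, and for groups of
type `3` not to be conjugate to groups of another type. -/
def Valid (n d m : ℕ) (k : Fin 4) : Prop :=
  ![Odd d ∧ Odd m, 2 ∣ d ∧ 2 * m ∣ n, 2 ∣ d ∧ 2 * m ∣ n,
    2 ∣ d ∧ 2 ∣ m ∧ n / d % 2 = n / m % 2 ∧ (m = 2 → ¬ 2 ∣ n / d)] k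

variable [Fact ℓ.Prime]

lemma Valid.isStd (hodd : Odd ℓ) {d m : ℕ} {k : Fin 4} (h : Valid (ℓ - 1) d m k)
    (hdn : d ∣ ℓ - 1) (hmn : m ∣ ℓ - 1) : IsStd d m (stdH ℓ d m k) := by
  fin_cases k
  · exact isStd_oddH h.2 hmn
  · exact isStd_sqH hodd h.1 h.2
  · exact isStd_sqH hodd h.1 h.2
  · exact isStd_nsqH hodd h.1 h.2.1 hdn hmn h.2.2.1

lemma Valid.stdT_pow {d m : ℕ} {k : Fin 4} (h : Valid (ℓ - 1) d m k)
    (hdn : d ∣ ℓ - 1) : stdT ℓ d k ^ d = 1 := by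
  fin_cases k
  · exact one_pow d
  · exact (even_iff_two_dvd.2 h.1).neg_one_pow
  · change (-zeta ℓ d) ^ d = 1
    rw [(even_iff_two_dvd.2 h.1).neg_pow]
    exact pow_eq_one_of_half h.1 (Or.inr (zeta_pow_half h.1 hdn))
  · exact (even_iff_two_dvd.2 h.1).neg_one_pow

lemma isCsPlusElt_of_mem_grp {H : Subgroup ((ZMod ℓ)ˣ × (ZMod ℓ)ˣ)} {t : (ZMod ℓ)ˣ}
    (hs : ∀ x ∈ H, x.swap ∈ H) (ht : (t, t) ∈ H) {g : GL2 ℓ} (hg : g ∈ grp H t) :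
    IsCsPlusElt g := by
  rw [isCsPlusElt_iff]
  rcases (mem_grp hs ht g).1 hg with ⟨x, -, h⟩ | ⟨x, -, h⟩
  · exact Or.inl ⟨x, h⟩
  · exact Or.inr ⟨_, _, h⟩

lemma comap_grp {H : Subgroup ((ZMod ℓ)ˣ × (ZMod ℓ)ˣ)} {t : (ZMod ℓ)ˣ}
    (hs : ∀ x ∈ H, x.swap ∈ H) (ht : (t, t) ∈ H) : (grp H t).comap dg = H := by
  ext x
  exact dg_mem_grp hs ht x

lemma IsStd.areConj_grp_mul {d m : ℕ} {H : Subgroup ((ZMod ℓ)ˣ × (ZMod ℓ)ˣ)} (h : IsStd d m H)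
    {t t' : (ZMod ℓ)ˣ} (ht : t ^ d = 1) {x : (ZMod ℓ)ˣ × (ZMod ℓ)ˣ} (hx : x ∈ H)
    (ht' : x.1 * x.2 * t = t') : AreConj (grp H t) (grp H t') := by
  have htH := (h.scal t).2 ht
  have := (areConj_grp (G := grp H t) (fun _ => isCsPlusElt_of_mem_grp h.swap htH)
    (by rw [comap_grp h.swap htH]; exact h.swap) (p := x.1) (q := x.2 * t)
    ((ad_mem_grp h.swap htH _ _).2 (by rwa [mul_div_cancel_right]))).2
  rwa [comap_grp h.swap htH, ← mul_assoc, ht'] at this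

lemma IsStd.areConj_grp_of_sq {d m : ℕ} {H : Subgroup ((ZMod ℓ)ˣ × (ZMod ℓ)ˣ)}
    (h : IsStd d m H) (hodd : Odd ℓ) (hd : 2 ∣ d) (hdn : d ∣ ℓ - 1) {t t' : (ZMod ℓ)ˣ}
    (ht : t ^ d = 1) (ht' : (t' / t) ^ (d / 2) = 1) : AreConj (grp H t) (grp H t') := by
  obtain ⟨s, hs, hst⟩ := exists_sq_of_pow_half hodd hd hdn ht'
  exact h.areConj_grp_mul ht ((h.scal s).2 hs)
    (by rw [← sq]; change s ^ 2 * t = t'; rw [hst, div_mul_cancel])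

lemma areConj_stdG_of_sq (hodd : Odd ℓ) {d m : ℕ} {G : Subgroup (GL2 ℓ)}
    (hG : ∀ x ∈ G, IsCsPlusElt x) (h : IsStd d m (G.comap dg)) {p q : (ZMod ℓ)ˣ}
    (hpq : ad p q ∈ G) (hd : 2 ∣ d) (hdn : d ∣ ℓ - 1)
    (hH : ∀ x ∈ G.comap dg, (x.1 * x.2) ^ (d / 2) = 1) :
    ∃ k, Valid (ℓ - 1) d m k ∧ AreConj G (stdG ℓ d m k) := by
  obtain ⟨ht, hconj⟩ := areConj_grp hG h.swap hpq
  obtain ⟨hm, hsq⟩ := h.eq_sqH hodd hd hdn hH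
  rw [h.scal] at ht
  rw [hsq] at hconj h
  have ht1 : (-(p * q)) ^ d = 1 := by rw [(even_iff_two_dvd.2 hd).neg_pow, ht]
  rcases pow_half_eq hd ht1 with h1 | h1
  · refine ⟨1, ⟨hd, hm⟩, hconj.trans (h.areConj_grp_of_sq hodd hd hdn ht ?_)⟩
    change (-1 / (p * q)) ^ _ = 1
    rw [neg_div, ← div_neg, one_div, inv_pow, h1, inv_one]
  · refine ⟨2, ⟨hd, hm⟩, hconj.trans (h.areConj_grp_of_sq hodd hd hdn ht ?_)⟩
    change (-zeta ℓ d / (p * q)) ^ _ = 1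
    rw [neg_div, ← div_neg, div_pow, h1, zeta_pow_half hd hdn, div_self']

lemma areConj_stdG_of_odd {d m : ℕ} {G : Subgroup (GL2 ℓ)}
    (hG : ∀ x ∈ G, IsCsPlusElt x) (h : IsStd d m (G.comap dg)) {p q : (ZMod ℓ)ˣ}
    (hpq : ad p q ∈ G) (hd : Odd d) (hm2 : 2 ≤ m) (hmn : m ∣ ℓ - 1) :
    ∃ k, Valid (ℓ - 1) d m k ∧ AreConj G (stdG ℓ d m k) := by
  obtain ⟨ht, hconj⟩ := areConj_grp hG h.swap hpq
  obtain ⟨hm, hH⟩ := h.eq_oddH hd hm2 hmn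
  rw [h.scal] at ht
  rw [hH] at hconj h
  refine ⟨0, ⟨hd, hm⟩, hconj.trans ?_⟩
  obtain ⟨e, he⟩ := hd
  have hs : ((p * q) ^ e) ^ d = 1 := by rw [pow_right_comm, ht, one_pow]
  refine h.areConj_grp_mul ht ((h.scal _).2 hs) ?_
  rw [← pow_add, ← pow_succ, show e + e + 1 = d by omega, ht]
  rfl

lemma areConj_stdG_of_not_sq (hodd : Odd ℓ) {d m : ℕ} {G : Subgroup (GL2 ℓ)}
    (hG : ∀ x ∈ G, IsCsPlusElt x) (h : IsStd d m (G.comap dg)) {p q : (ZMod ℓ)ˣ}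
    (hpq : ad p q ∈ G) (hd : 2 ∣ d) (hdn : d ∣ ℓ - 1) (hm2 : 2 ≤ m) (hmn : m ∣ ℓ - 1)
    (hH : ¬ ∀ x ∈ G.comap dg, (x.1 * x.2) ^ (d / 2) = 1) :
    2 ∣ m ∧ (ℓ - 1) / d % 2 = (ℓ - 1) / m % 2 ∧ AreConj G (stdG ℓ d m 3) := by
  obtain ⟨ht, hconj⟩ := areConj_grp hG h.swap hpq
  obtain ⟨hm, hpar, hnsq⟩ := h.eq_nsqH hodd hd hdn hm2 hmn hH
  rw [h.scal] at ht
  rw [hnsq] at hconj h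
  refine ⟨hm, hpar, hconj.trans ?_⟩
  have ht1 : (-(p * q)) ^ d = 1 := by rw [(even_iff_two_dvd.2 hd).neg_pow, ht]
  rcases pow_half_eq hd ht1 with h1 | h1
  · refine h.areConj_grp_of_sq hodd hd hdn ht ?_
    change (-1 / (p * q)) ^ _ = 1
    rw [neg_div, ← div_neg, one_div, inv_pow, h1, inv_one]
  · obtain ⟨x, hx, -, hx1⟩ := exists_mem_nsqH hodd hd hm hdn hmn hpar
    have ht2 : (x.1 * x.2 * (p * q)) ^ d = 1 := by rw [mul_pow, h.prod_pow hx, ht, one_mul]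
    refine (h.areConj_grp_mul ht hx rfl).trans (h.areConj_grp_of_sq hodd hd hdn ht2 ?_)
    change (-1 / (x.1 * x.2 * (p * q))) ^ _ = 1
    rw [neg_div, ← div_neg, ← mul_neg, one_div, inv_pow, mul_pow, h1, hx1]
    simp

lemma eq_of_forall_pow_iff {d d' : ℕ} (hd : d ∣ ℓ - 1) (hd' : d' ∣ ℓ - 1)
    (h : ∀ z : (ZMod ℓ)ˣ, z ^ d = 1 ↔ z ^ d' = 1) : d = d' := by
  obtain ⟨z, hz⟩ := exists_orderOf_eq hd
  obtain ⟨z', hz'⟩ := exists_orderOf_eq hd'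
  apply Nat.dvd_antisymm
  · rw [← hz, orderOf_dvd_iff_pow_eq_one, ← h, ← hz, pow_orderOf_eq_one]
  · rw [← hz', orderOf_dvd_iff_pow_eq_one, h, ← hz', pow_orderOf_eq_one]

/-- A standard group of type `3` with projective image the Klein four-group is conjugate to a
standard group of type `1` or `2` when its scalars are squares. -/
lemma areConj_stdG_three_two (hodd : Odd ℓ) {d : ℕ} (hd : 2 ∣ d) (hdn : d ∣ ℓ - 1)
    (hpar : (ℓ - 1) / d % 2 = (ℓ - 1) / 2 % 2) (he : 2 ∣ (ℓ - 1) / d) :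
    ∃ k, Valid (ℓ - 1) d 2 k ∧ AreConj (stdG ℓ d 2 3) (stdG ℓ d 2 k) := by
  have hn2 := hd.trans hdn
  have hstd := isStd_nsqH hodd hd dvd_rfl hdn hn2 hpar
  have ht1 : (-1 : (ZMod ℓ)ˣ) ^ d = 1 := (even_iff_two_dvd.2 hd).neg_one_pow
  have htH := (hstd.scal _).2 ht1
  obtain ⟨i, hi⟩ := (isSquare_unit_iff hodd (-1)).2 (by
    exact (Nat.even_iff.2 (by omega : (ℓ - 1) / 2 % 2 = 0)).neg_one_pow)
  have hi' : (i : ZMod ℓ) * i = -1 := by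
    rw [← sq, ← Units.val_pow_eq_pow_val, hi]; simp
  have h2 : (2 : ZMod ℓ) ≠ 0 := by
    intro h
    apply neg_one_ne_one_units hodd
    ext
    push_cast
    linear_combination -h
  let Q : GL2 ℓ := Matrix.GeneralLinearGroup.mkOfDetNeZero !![1, 1; (i : ZMod ℓ), -i] (by
    rw [Matrix.det_fin_two_of]
    rw [show (1 : ZMod ℓ) * -i - 1 * i = -(2 * i) by ring]
    exact neg_ne_zero.2 (mul_ne_zero h2 i.ne_zero))
  have hQ : mat Q = !![1, 1; (i : ZMod ℓ), -i] := rfl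
  let G : Subgroup (GL2 ℓ) := (stdG ℓ d 2 3).map (MulAut.conj Q⁻¹).toMonoidHom
  have hconj : AreConj (stdG ℓ d 2 3) G := by
    refine ⟨Q⁻¹, fun x => ⟨fun hx => ⟨x, hx, rfl⟩, ?_⟩⟩
    rintro ⟨y, hy, hyx⟩
    rwa [← (MulAut.conj Q⁻¹).injective hyx]
  have hcases : ∀ g ∈ G, ∃ s : (ZMod ℓ)ˣ,
      (s ^ d = 1 ∧ (g = dg (s, s) ∨ g = dg (s * i, -(s * i)))) ∨
      g = ad s s ∨ g = ad (-(s * i)) (s * i) := by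
    rintro _ ⟨g, hg, rfl⟩
    have key (g' : GL2 ℓ) (h : mat g * mat Q = mat Q * mat g') :
        (MulAut.conj Q⁻¹).toMonoidHom g = g' := by
      change Q⁻¹ * g * Q⁻¹⁻¹ = g'
      rw [inv_inv, mul_assoc, inv_mul_eq_iff_eq_mul]
      exact mat_injective h
    have hmem {x : (ZMod ℓ)ˣ × (ZMod ℓ)ˣ} (hx : x ∈ nsqH ℓ d 2) :
        ∃ s, (x = (s, s) ∧ s ^ d = 1) ∨ x = (s, -s) := by
      obtain ⟨hx1, hx2⟩ := mem_nsqH.1 hx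
      obtain ⟨p, q⟩ := x
      change (p * q) ^ (d / 2) = (p / q) ^ 1 at hx1
      change (p / q) ^ 2 = 1 at hx2
      rw [pow_one] at hx1
      refine ⟨p, (unit_eq_one_or_neg_one hx2).imp (fun h1 => ?_) fun h1 => ?_⟩
      · obtain rfl := div_eq_one.1 h1
        rw [h1, mul_self_pow_half hd] at hx1
        exact ⟨rfl, hx1⟩
      · rw [div_eq_iff_eq_mul, neg_one_mul] at h1
        rw [h1, neg_neg]
    rcases (mem_grp hstd.swap htH g).1 hg with ⟨x, hx, rfl⟩ | ⟨x, hx, rfl⟩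
    · obtain ⟨s, ⟨rfl, hs⟩ | rfl⟩ := hmem hx
      · refine ⟨s, Or.inl ⟨hs, Or.inl (key _ ?_)⟩⟩
        rw [mat_dg, hQ]
        ext a b
        fin_cases a <;> fin_cases b <;> simp [Matrix.mul_apply, Fin.sum_univ_two] <;> ring
      · refine ⟨s, Or.inr (Or.inl (key _ ?_))⟩
        rw [mat_dg, mat_ad, hQ]
        ext a b
        fin_cases a <;> fin_cases b <;> simp [Matrix.mul_apply, Fin.sum_univ_two] <;> ring
    · obtain ⟨s, ⟨rfl, hs⟩ | rfl⟩ := hmem hx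
      · refine ⟨s, Or.inl ⟨hs, Or.inr (key _ ?_)⟩⟩
        rw [mat_dg, mat_ad, hQ]
        ext a b
        fin_cases a <;> fin_cases b <;> simp [Matrix.mul_apply, Fin.sum_univ_two] <;>
          linear_combination -(s : ZMod ℓ) * hi'
      · refine ⟨s, Or.inr (Or.inr (key _ ?_))⟩
        rw [mat_ad, mat_ad, hQ]
        ext a b
        fin_cases a <;> fin_cases b <;> simp [Matrix.mul_apply, Fin.sum_univ_two] <;>
          linear_combination (s : ZMod ℓ) * hi'
  have hGcs : ∀ g ∈ G, IsCsPlusElt g := by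
    intro g hg
    rw [isCsPlusElt_iff]
    obtain ⟨s, ⟨-, rfl | rfl⟩ | rfl | rfl⟩ := hcases g hg
    exacts [Or.inl ⟨_, rfl⟩, Or.inl ⟨_, rfl⟩, Or.inr ⟨_, _, rfl⟩, Or.inr ⟨_, _, rfl⟩]
  have hGD : IsDihedralProj G := hconj.symm.isDihedralProj
    ⟨2, le_rfl, hstd.nonempty_mulEquiv ht1⟩
  obtain ⟨d', m', hd', hm', hm2, hG, p, q, hpq⟩ := exists_isStd hGcs hGD
  obtain rfl : d = d' := by
    refine eq_of_forall_pow_iff hdn hd' fun z => ?_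
    rw [← hG.scal, ← hstd.scal, ← dg_mem_grp hstd.swap htH]
    exact hconj.dg_mem_iff z
  obtain rfl : m' = 2 := by
    have : NeZero m' := ⟨by omega⟩
    obtain ⟨ht2, hconj'⟩ := areConj_grp hGcs hG.swap hpq
    obtain ⟨e⟩ := (hconj.trans hconj').nonempty_projImage
    have h1 := hG.card_projImage ((hG.scal _).1 ht2)
    have h3 : Nat.card (projImage (stdG ℓ d 2 3)) = 2 * 2 := hstd.card_projImage ht1
    rw [← Nat.card_congr e.toEquiv, h3] at h1
    omega
  obtain ⟨k, hk, hGk⟩ := areConj_stdG_of_sq hodd hGcs hG hpq hd hdn (by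
    intro x hx
    obtain ⟨s, ⟨hs, h | h⟩ | h | h⟩ := hcases _ hx
    · rw [dg_injective h, mul_self_pow_half hd, hs]
    · rw [dg_injective h]
      change (s * i * -(s * i)) ^ _ = 1
      rw [mul_neg, ← sq, mul_pow s, hi, mul_neg, mul_one, neg_neg, sq, mul_self_pow_half hd, hs]
    · exact absurd h (dg_ne_ad _ _ _)
    · exact absurd h (dg_ne_ad _ _ _))
  exact ⟨k, hk, hconj.trans hGk⟩

lemma exists_areConj_stdG (hodd : Odd ℓ) {G : Subgroup (GL2 ℓ)} (hG : ∀ x ∈ G, IsCsPlusElt x)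
    (hD : IsDihedralProj G) : ∃ d m k, d ∣ ℓ - 1 ∧ m ∣ ℓ - 1 ∧ m ≠ 1 ∧
      Valid (ℓ - 1) d m k ∧ AreConj G (stdG ℓ d m k) := by
  obtain ⟨d, m, hdn, hmn, hm2, h, p, q, hpq⟩ := exists_isStd hG hD
  suffices ∃ k, Valid (ℓ - 1) d m k ∧ AreConj G (stdG ℓ d m k) by
    obtain ⟨k, hk⟩ := this
    exact ⟨d, m, k, hdn, hmn, by omega, hk⟩
  rcases Nat.even_or_odd d with hd | hd
  · replace hd := hd.two_dvd
    by_cases hH : ∀ x ∈ G.comap dg, (x.1 * x.2) ^ (d / 2) = 1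
    · exact areConj_stdG_of_sq hodd hG h hpq hd hdn hH
    · obtain ⟨hm, hpar, hconj⟩ := areConj_stdG_of_not_sq hodd hG h hpq hd hdn hm2 hmn hH
      by_cases hfuse : m = 2 ∧ 2 ∣ (ℓ - 1) / d
      · obtain ⟨rfl, he⟩ := hfuse
        obtain ⟨k, hk, hk'⟩ := areConj_stdG_three_two hodd hd hdn hpar he
        exact ⟨k, hk, hconj.trans hk'⟩
      · exact ⟨3, ⟨hd, hm, hpar, fun h1 h2 => hfuse ⟨h1, h2⟩⟩, hconj⟩
  · exact areConj_stdG_of_odd hG h hpq hd hm2 hmn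

end Classification

section Distinguishing

variable {ℓ : ℕ}

lemma val_det_GL2 (g : GL2 ℓ) : (Matrix.GeneralLinearGroup.det g : ZMod ℓ) = (mat g).det := rfl

lemma det_conj_GL2 (c g : GL2 ℓ) :
    Matrix.GeneralLinearGroup.det (c * g * c⁻¹) = Matrix.GeneralLinearGroup.det g := by
  rw [map_mul, map_mul, map_inv, mul_comm, inv_mul_cancel_left]

lemma trace_conj_GL2 (c g : GL2 ℓ) : (mat (c * g * c⁻¹)).trace = (mat g).trace :=
  Matrix.trace_units_conj c (mat g)

lemma AreConj.det_pow {A B : Subgroup (GL2 ℓ)} (h : AreConj A B) {e : ℕ}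
    (hB : ∀ g ∈ B, Matrix.GeneralLinearGroup.det g ^ e = 1) :
    ∀ g ∈ A, Matrix.GeneralLinearGroup.det g ^ e = 1 := by
  obtain ⟨c, hc⟩ := h
  intro g hg
  rw [← det_conj_GL2 c]
  exact hB _ ((hc g).1 hg)

lemma AreConj.det_pow_of_trace {A B : Subgroup (GL2 ℓ)} (h : AreConj A B) {e : ℕ}
    (hB : ∀ g ∈ B, (mat g).trace ≠ 0 → Matrix.GeneralLinearGroup.det g ^ e = 1) :
    ∀ g ∈ A, (mat g).trace ≠ 0 → Matrix.GeneralLinearGroup.det g ^ e = 1 := by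
  obtain ⟨c, hc⟩ := h
  intro g hg
  rw [← det_conj_GL2 c, ← trace_conj_GL2 c]
  exact hB _ ((hc g).1 hg)

variable [Fact ℓ.Prime]

lemma det_dg (x : (ZMod ℓ)ˣ × (ZMod ℓ)ˣ) :
    Matrix.GeneralLinearGroup.det (dg x) = x.1 * x.2 := by
  ext
  rw [val_det_GL2]
  simp [Matrix.det_fin_two]

lemma det_ad (p q : (ZMod ℓ)ˣ) : Matrix.GeneralLinearGroup.det (ad p q) = -(p * q) := by
  ext
  rw [val_det_GL2]
  simp [Matrix.det_fin_two]

lemma det_pow_of_mem_stdG_one (hodd : Odd ℓ) {d m : ℕ} (h : Valid (ℓ - 1) d m 1)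
    (hdn : d ∣ ℓ - 1) (hmn : m ∣ ℓ - 1) {g : GL2 ℓ} (hg : g ∈ stdG ℓ d m 1) :
    Matrix.GeneralLinearGroup.det g ^ (d / 2) = 1 := by
  have hs := h.isStd hodd hdn hmn
  rcases (mem_grp hs.swap ((hs.scal _).2 (h.stdT_pow hdn)) g).1 hg with
    ⟨x, hx, rfl⟩ | ⟨x, hx, rfl⟩
  · rw [det_dg]
    exact (mem_sqH.1 hx).1
  · rw [det_ad]
    change (-(x.1 * (x.2 * -1))) ^ (d / 2) = 1
    rw [mul_neg_one, mul_neg, neg_neg]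
    exact (mem_sqH.1 hx).1

lemma det_pow_of_mem_stdG_two (hodd : Odd ℓ) {d m : ℕ} (h : Valid (ℓ - 1) d m 2)
    (hdn : d ∣ ℓ - 1) (hmn : m ∣ ℓ - 1) {g : GL2 ℓ} (hg : g ∈ stdG ℓ d m 2)
    (htr : (mat g).trace ≠ 0) : Matrix.GeneralLinearGroup.det g ^ (d / 2) = 1 := by
  have hs := h.isStd hodd hdn hmn
  rcases (mem_grp hs.swap ((hs.scal _).2 (h.stdT_pow hdn)) g).1 hg with
    ⟨x, hx, rfl⟩ | ⟨x, hx, rfl⟩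
  · rw [det_dg]
    exact (mem_sqH.1 hx).1
  · simp [Matrix.trace_fin_two] at htr

lemma exists_mem_stdG_two (hodd : Odd ℓ) {d m : ℕ} (h : Valid (ℓ - 1) d m 2)
    (hdn : d ∣ ℓ - 1) (hmn : m ∣ ℓ - 1) :
    ∃ g ∈ stdG ℓ d m 2, Matrix.GeneralLinearGroup.det g ^ (d / 2) = -1 := by
  have hs := h.isStd hodd hdn hmn
  refine ⟨ad 1 (-zeta ℓ d), (ad_mem_grp hs.swap ((hs.scal _).2 (h.stdT_pow hdn)) _ _).2 ?_, ?_⟩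
  · change (1, -zeta ℓ d / -zeta ℓ d) ∈ _
    rw [div_self']
    exact one_mem _
  · rw [det_ad, one_mul, neg_neg, zeta_pow_half h.1 hdn]

lemma exists_mem_stdG_three (hodd : Odd ℓ) {d m : ℕ} (h : Valid (ℓ - 1) d m 3)
    (hdn : d ∣ ℓ - 1) (hmn : m ∣ ℓ - 1) (hm : m ≠ 2) :
    ∃ g ∈ stdG ℓ d m 3, (mat g).trace ≠ 0 ∧
      Matrix.GeneralLinearGroup.det g ^ (d / 2) = -1 := by
  have hs := h.isStd hodd hdn hmn
  obtain ⟨x, hx, hxm, hx1⟩ := exists_mem_nsqH hodd h.1 h.2.1 hdn hmn h.2.2.1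
  refine ⟨dg x, (dg_mem_grp hs.swap ((hs.scal _).2 (h.stdT_pow hdn)) _).2 hx, ?_, ?_⟩
  · intro htr
    have h1 : x.1 = -x.2 := by
      ext
      simpa [Matrix.trace_fin_two, add_eq_zero_iff_eq_neg] using htr
    rw [h1, neg_div, div_self', orderOf_eq_prime (p := 2) (by simp)
      (neg_one_ne_one_units hodd)] at hxm
    exact hm hxm.symm
  · rw [det_dg, hx1]

lemma Valid.not_areConj_one (hodd : Odd ℓ) {d m : ℕ} {k : Fin 4} (h1 : Valid (ℓ - 1) d m 1)
    (h : Valid (ℓ - 1) d m k) (hk : k = 2 ∨ k = 3) (hdn : d ∣ ℓ - 1) (hmn : m ∣ ℓ - 1) :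
    ¬ AreConj (stdG ℓ d m k) (stdG ℓ d m 1) := by
  intro hc
  have hB := hc.det_pow fun g hg => det_pow_of_mem_stdG_one hodd h1 hdn hmn hg
  rcases hk with rfl | rfl
  · obtain ⟨g, hg, hg1⟩ := exists_mem_stdG_two hodd h hdn hmn
    exact neg_one_ne_one_units hodd (hg1.symm.trans (hB g hg))
  · obtain ⟨x, hx, -, hx1⟩ := exists_mem_nsqH hodd h.1 h.2.1 hdn hmn h.2.2.1
    have hs := h.isStd hodd hdn hmn
    have := hB (dg x) ((dg_mem_grp hs.swap ((hs.scal _).2 (h.stdT_pow hdn)) _).2 hx)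
    rw [det_dg, hx1] at this
    exact neg_one_ne_one_units hodd this

lemma Valid.not_areConj_two (hodd : Odd ℓ) {d m : ℕ} (h2 : Valid (ℓ - 1) d m 2)
    (h : Valid (ℓ - 1) d m 3) (hdn : d ∣ ℓ - 1) (hmn : m ∣ ℓ - 1) :
    ¬ AreConj (stdG ℓ d m 3) (stdG ℓ d m 2) := by
  intro hc
  have hm : m ≠ 2 := by
    rintro rfl
    have h3 : 2 ∣ (ℓ - 1) / 2 := (Nat.dvd_div_iff_mul_dvd hmn).2 h2.2
    have h4 := h.2.2.1
    have h5 := h.2.2.2 rfl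
    omega
  obtain ⟨g, hg, htr, hg1⟩ := exists_mem_stdG_three hodd h hdn hmn hm
  exact neg_one_ne_one_units hodd (hg1.symm.trans (hc.det_pow_of_trace
    (fun g hg => det_pow_of_mem_stdG_two hodd h2 hdn hmn hg) g hg htr))

lemma AreConj.stdG_type_eq (hodd : Odd ℓ) {d m : ℕ} {k k' : Fin 4} (h : Valid (ℓ - 1) d m k)
    (h' : Valid (ℓ - 1) d m k') (hdn : d ∣ ℓ - 1) (hmn : m ∣ ℓ - 1)
    (hc : AreConj (stdG ℓ d m k) (stdG ℓ d m k')) : k = k' := by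
  have hne {a b : ℕ} {j : Fin 4} (h0 : Valid (ℓ - 1) a b 0) (hj : Valid (ℓ - 1) a b j) :
      j = 0 := by
    have : ¬ 2 ∣ a := h0.1.not_two_dvd_nat
    fin_cases j
    · rfl
    all_goals exact absurd hj.1 this
  fin_cases k <;> fin_cases k'
  · rfl
  · exact (hne h h').symm
  · exact (hne h h').symm
  · exact (hne h h').symm
  · exact hne h' h
  · rfl
  · exact absurd hc.symm (h.not_areConj_one hodd h' (Or.inl rfl) hdn hmn)
  · exact absurd hc.symm (h.not_areConj_one hodd h' (Or.inr rfl) hdn hmn)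
  · exact hne h' h
  · exact absurd hc (h'.not_areConj_one hodd h (Or.inl rfl) hdn hmn)
  · rfl
  · exact absurd hc.symm (h.not_areConj_two hodd h' hdn hmn)
  · exact hne h' h
  · exact absurd hc (h'.not_areConj_one hodd h (Or.inr rfl) hdn hmn)
  · exact absurd hc (h'.not_areConj_two hodd h hdn hmn)
  · rfl

lemma AreConj.stdG_eq (hodd : Odd ℓ) {d m d' m' : ℕ} {k k' : Fin 4}
    (h : Valid (ℓ - 1) d m k) (h' : Valid (ℓ - 1) d' m' k') (hdn : d ∣ ℓ - 1)
    (hmn : m ∣ ℓ - 1) (hdn' : d' ∣ ℓ - 1) (hmn' : m' ∣ ℓ - 1)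
    (hc : AreConj (stdG ℓ d m k) (stdG ℓ d' m' k')) : d = d' ∧ m = m' ∧ k = k' := by
  have hs := h.isStd hodd hdn hmn
  have hs' := h'.isStd hodd hdn' hmn'
  have ht := h.stdT_pow hdn
  have ht' := h'.stdT_pow hdn'
  have hn : 0 < ℓ - 1 := Nat.sub_pos_of_lt (Fact.out : ℓ.Prime).one_lt
  obtain rfl : d = d' := by
    refine eq_of_forall_pow_iff hdn hdn' fun z => ?_
    rw [← hs.scal, ← hs'.scal, ← dg_mem_grp hs.swap ((hs.scal _).2 ht),
      ← dg_mem_grp hs'.swap ((hs'.scal _).2 ht')]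
    exact hc.dg_mem_iff z
  obtain rfl : m = m' := by
    have : NeZero m := ⟨(Nat.pos_of_dvd_of_pos hmn hn).ne'⟩
    have : NeZero m' := ⟨(Nat.pos_of_dvd_of_pos hmn' hn).ne'⟩
    obtain ⟨e⟩ := hc.nonempty_projImage
    have h1 := Nat.card_congr e.toEquiv
    unfold stdG at h1
    rw [hs.card_projImage ht, hs'.card_projImage ht'] at h1
    omega
  exact ⟨rfl, rfl, hc.stdG_type_eq hodd h h' hdn hmn⟩

end Distinguishing

section Counting

/-- The parameters of the standard groups, where `n = ℓ - 1`. -/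
def ValidParam (n : ℕ) (x : Fin 4 × ℕ × ℕ) : Prop :=
  x.2.1 ∣ n ∧ x.2.2 ∣ n ∧ x.2.2 ≠ 1 ∧ Valid n x.2.1 x.2.2 x.1

lemma conjClassCount_eq_card {G ι : Type*} [Group G] {P : Subgroup G → Prop} (f : ι → Subgroup G)
    (hf : ∀ i, P (f i)) (hinj : ∀ i j, AreConj (f i) (f j) → i = j)
    (hsurj : ∀ H, P H → ∃ i, AreConj H (f i)) : conjClassCount P = Nat.card ι := by
  symm
  refine Nat.card_eq_of_bijective (fun i => Quotient.mk _ ⟨f i, hf i⟩) ⟨fun i j h => ?_, ?_⟩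
  · replace h := Quotient.exact h
    exact hinj i j ((areConj_iff_orbitRel _ _).2 h)
  · rintro ⟨H, hH⟩
    obtain ⟨i, hi⟩ := hsurj H hH
    exact ⟨i, Quotient.sound ((areConj_iff_orbitRel _ _).1 hi.symm)⟩

lemma conjClassCount_csPlus_dihedral {ℓ : ℕ} [Fact ℓ.Prime] (hodd : Odd ℓ) :
    conjClassCount (fun H : Subgroup (GL2 ℓ) =>
      (∃ c : GL2 ℓ, ∀ x ∈ H, IsCsPlusElt (c * x * c⁻¹)) ∧ IsDihedralProj H) =
      Nat.card {x // ValidParam (ℓ - 1) x} := by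
  refine conjClassCount_eq_card (fun x => stdG ℓ x.1.2.1 x.1.2.2 x.1.1) ?_ ?_ ?_
  · rintro ⟨⟨k, d, m⟩, hdn, hmn, hm, h⟩
    dsimp only at hdn hmn hm h ⊢
    have hs := h.isStd hodd hdn hmn
    have ht := h.stdT_pow hdn
    have hm0 : m ≠ 0 := by
      rintro rfl
      have := Nat.sub_pos_of_lt (Fact.out : ℓ.Prime).one_lt
      exact this.ne' (zero_dvd_iff.1 hmn)
    have : NeZero m := ⟨hm0⟩
    refine ⟨⟨1, fun x hx => ?_⟩, m, by omega, hs.nonempty_mulEquiv ht⟩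
    rw [one_mul, inv_one, mul_one]
    exact isCsPlusElt_of_mem_grp hs.swap ((hs.scal _).2 ht) hx
  · rintro ⟨⟨k, d, m⟩, hdn, hmn, hm, h⟩ ⟨⟨k', d', m'⟩, hdn', hmn', hm', h'⟩ hc
    obtain ⟨rfl, rfl, rfl⟩ := hc.stdG_eq hodd h h' hdn hmn hdn' hmn'
    rfl
  · rintro H ⟨⟨c, hc⟩, hD⟩
    have hH : AreConj H (H.map (MulAut.conj c).toMonoidHom) := by
      refine ⟨c, fun x => ⟨fun hx => ⟨x, hx, rfl⟩, ?_⟩⟩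
      rintro ⟨y, hy, hyx⟩
      rwa [← (MulAut.conj c).injective hyx]
    obtain ⟨d, m, k, hdn, hmn, hm, h, hk⟩ := exists_areConj_stdG hodd
      (by rintro _ ⟨x, hx, rfl⟩; exact hc x hx) (hH.symm.isDihedralProj hD)
    exact ⟨⟨(k, d, m), hdn, hmn, hm, h⟩, hH.trans hk⟩

end Counting

section Arithmetic

variable {j q : ℕ}

lemma dvd_two_pow_mul_and_odd (hq : Odd q) {a k : ℕ} : a ∣ 2 ^ k * q ∧ Odd a ↔ a ∣ q := by
  constructor
  · rintro ⟨h, ha⟩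
    exact (Nat.Coprime.pow_right k ha.coprime_two_right).dvd_of_dvd_mul_left h
  · intro h
    exact ⟨h.mul_left _, hq.of_dvd_nat h⟩

lemma tauFun_two_pow_mul (hq : Odd q) (k : ℕ) : tauFun (2 ^ k * q) = (k + 1) * tauFun q := by
  unfold tauFun
  rw [(Nat.Coprime.pow_left k hq.coprime_two_left).card_divisors_mul,
    Nat.divisors_prime_pow Nat.prime_two, Finset.card_map, Finset.card_range]

lemma tauFun_pos (hq : Odd q) : 0 < tauFun q :=
  Finset.card_pos.2 ⟨1, Nat.one_mem_divisors.2 hq.pos.ne'⟩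

lemma betaFun_two_pow_mul (hq : Odd q) :
    betaFun (2 ^ (j + 1) * q) = (2 * j ^ 2 + 2 * j + 3) * tauFun q ^ 2 := by
  have hq0 := hq.pos.ne'
  have h2q : ¬ 2 ∣ q := hq.not_two_dvd_nat
  have hcop : Nat.Coprime (2 ^ (j + 1)) q := Nat.Coprime.pow_left _ hq.coprime_two_left
  have hfac : (2 ^ (j + 1) * q).factorization 2 = j + 1 := by
    rw [Nat.factorization_mul (by positivity) hq0, Nat.prime_two.factorization_pow]
    simp [Nat.factorization_eq_zero_of_not_dvd h2q]
  have hprimes : (2 ^ (j + 1) * q).primeFactors.erase 2 = q.primeFactors := by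
    rw [hcop.primeFactors_mul, Nat.primeFactors_prime_pow j.succ_ne_zero Nat.prime_two,
      ← Finset.insert_eq, Finset.erase_insert]
    exact fun h => h2q (Nat.dvd_of_mem_primeFactors h)
  unfold betaFun
  rw [if_pos ((dvd_pow_self 2 j.succ_ne_zero).mul_right q), hfac, hprimes, Finset.prod_pow,
    tauFun, Nat.card_divisors hq0]
  congr 2
  · have : 2 * (j + 1) ^ 2 = 2 * j ^ 2 + 2 * j + 2 * (j + 1) := by ring
    omega
  · refine Finset.prod_congr rfl fun p hp => ?_
    rw [Nat.factorization_eq_of_coprime_right hcop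
      (Nat.mem_primeFactors_iff_mem_primeFactorsList.1 hp)]

/-- The parameters `(d, m)` of the standard groups of type `k`. -/
noncomputable def paramFinset (n : ℕ) (k : Fin 4) : Finset (ℕ × ℕ) :=
  open Classical in {x ∈ n.divisors ×ˢ n.divisors | x.2 ≠ 1 ∧ Valid n x.1 x.2 k}

lemma mem_paramFinset {n : ℕ} (hn : n ≠ 0) {k : Fin 4} {x : ℕ × ℕ} :
    x ∈ paramFinset n k ↔ ValidParam n (k, x) := by
  simp only [paramFinset, ValidParam, Finset.mem_filter, Finset.mem_product, Nat.mem_divisors]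
  tauto

lemma card_validParam {n : ℕ} (hn : n ≠ 0) :
    Nat.card {x // ValidParam n x} = ∑ k, (paramFinset n k).card := by
  rw [← Finset.card_sigma, ← Nat.card_eq_finsetCard]
  exact Nat.card_congr
    { toFun := fun x => ⟨⟨x.1.1, x.1.2⟩, by
        simpa using (mem_paramFinset hn).2 x.2⟩
      invFun := fun x => ⟨(x.1.1, x.1.2), by
        have := (Finset.mem_sigma.1 x.2).2
        exact (mem_paramFinset hn).1 this⟩
      left_inv := fun _ => rfl
      right_inv := fun _ => rfl }

lemma card_paramFinset_zero (hq : Odd q) :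
    (paramFinset (2 ^ (j + 1) * q) 0).card = tauFun q * (tauFun q - 1) := by
  have hq0 := hq.pos.ne'
  have : paramFinset (2 ^ (j + 1) * q) 0 = q.divisors ×ˢ q.divisors.erase 1 := by
    ext ⟨d, m⟩
    rw [mem_paramFinset (by positivity)]
    simp only [Finset.mem_product, Finset.mem_erase, Nat.mem_divisors, ← and_assoc,
      ← dvd_two_pow_mul_and_odd hq (k := j + 1)]
    change d ∣ _ ∧ m ∣ _ ∧ m ≠ 1 ∧ (Odd d ∧ Odd m) ↔ _
    tauto
  rw [this, Finset.card_product, Finset.card_erase_of_mem (Nat.one_mem_divisors.2 hq0)]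
  rfl

lemma card_paramFinset_sq {N : ℕ} (hN : N ≠ 0) {k : Fin 4} (hk : k = 1 ∨ k = 2) :
    (paramFinset (2 * N) k).card = tauFun N * (tauFun N - 1) := by
  have : paramFinset (2 * N) k =
      (N.divisors ×ˢ N.divisors.erase 1).image (Prod.map (2 * ·) id) := by
    ext ⟨d, m⟩
    rw [mem_paramFinset (by positivity)]
    have hV : Valid (2 * N) d m k ↔ 2 ∣ d ∧ 2 * m ∣ 2 * N := by
      rcases hk with rfl | rfl <;> rfl
    simp only [ValidParam, hV, Nat.mul_dvd_mul_iff_left two_pos, Finset.mem_image,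
      Finset.mem_product, Finset.mem_erase, Nat.mem_divisors, Prod.exists, Prod.map_apply, id,
      Prod.mk.injEq]
    constructor
    · rintro ⟨hd, -, hm1, ⟨d, rfl⟩, hm⟩
      exact ⟨d, m, ⟨⟨Nat.dvd_of_mul_dvd_mul_left two_pos hd, hN⟩, hm1, hm, hN⟩, rfl, rfl⟩
    · rintro ⟨a, b, ⟨⟨ha, -⟩, hb1, hb, -⟩, rfl, rfl⟩
      exact ⟨mul_dvd_mul_left 2 ha, hb.mul_left 2, hb1, dvd_mul_right 2 a, hb⟩
  rw [this, Finset.card_image_of_injective, Finset.card_product,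
    Finset.card_erase_of_mem (Nat.one_mem_divisors.2 hN)]
  · rfl
  · exact Function.Injective.prodMap (mul_right_injective₀ two_ne_zero) Function.injective_id

lemma card_divisors_filter_even (hq : Odd q) :
    {a ∈ (2 ^ j * q).divisors | 2 ∣ 2 ^ j * q / a}.card = j * tauFun q := by
  have hq0 := hq.pos.ne'
  rcases j with _ | j
  · rw [zero_mul, Finset.card_eq_zero, Finset.filter_eq_empty_iff]
    intro a ha h
    rw [pow_zero, one_mul] at ha h
    exact hq.not_two_dvd_nat (h.trans (Nat.div_dvd_of_dvd (Nat.dvd_of_mem_divisors ha)))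
  · rw [← tauFun_two_pow_mul hq, tauFun]
    congr 1
    ext a
    have h2 : 2 ^ (j + 1) * q = 2 * (2 ^ j * q) := by ring
    simp only [Finset.mem_filter, Nat.mem_divisors]
    constructor
    · rintro ⟨⟨h, -⟩, h'⟩
      rw [Nat.dvd_div_iff_mul_dvd h, h2, mul_comm a] at h'
      exact ⟨Nat.dvd_of_mul_dvd_mul_left two_pos h', by positivity⟩
    · rintro ⟨h, -⟩
      have h3 : a ∣ 2 ^ (j + 1) * q := h2 ▸ h.mul_left 2
      refine ⟨⟨h3, by positivity⟩, ?_⟩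
      rw [Nat.dvd_div_iff_mul_dvd h3, h2, mul_comm a]
      exact mul_dvd_mul_left 2 h

lemma card_divisors_filter_not_even (hq : Odd q) :
    {a ∈ (2 ^ j * q).divisors | ¬ 2 ∣ 2 ^ j * q / a}.card = tauFun q := by
  have h := Finset.card_filter_add_card_filter_not (s := (2 ^ j * q).divisors)
    (fun a => 2 ∣ 2 ^ j * q / a)
  have h' := tauFun_two_pow_mul hq j
  rw [card_divisors_filter_even hq, ← tauFun, h'] at h
  linarith

lemma card_paramFinset_three (hq : Odd q) :
    (paramFinset (2 * (2 ^ j * q)) 3).card =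
      tauFun q ^ 2 + j * tauFun q * (j * tauFun q - 1) := by
  have hq0 := hq.pos.ne'
  set N := 2 ^ j * q with hNdef
  have hN : N ≠ 0 := by positivity
  set E := {a ∈ N.divisors | 2 ∣ N / a} with hE
  set O := {a ∈ N.divisors | ¬ 2 ∣ N / a} with hO
  have hEO (a : ℕ) (h : a ∈ O) : a ∉ E := fun h' =>
    (Finset.mem_filter.1 h).2 (Finset.mem_filter.1 h').2
  have : paramFinset (2 * N) 3 =
      (O ×ˢ O ∪ E ×ˢ E.erase 1).image (Prod.map (2 * ·) (2 * ·)) := by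
    ext ⟨d, m⟩
    rw [mem_paramFinset (by positivity)]
    change d ∣ _ ∧ m ∣ _ ∧ m ≠ 1 ∧ (2 ∣ d ∧ 2 ∣ m ∧ 2 * N / d % 2 = 2 * N / m % 2 ∧
      (m = 2 → ¬ 2 ∣ 2 * N / d)) ↔ _
    simp only [hE, hO, Finset.mem_image, Finset.mem_union, Finset.mem_filter,
      Finset.mem_product, Finset.mem_erase, Nat.mem_divisors, Prod.exists, Prod.map_apply,
      Prod.mk.injEq]
    constructor
    · rintro ⟨hd, hm, -, ⟨d, rfl⟩, ⟨m, rfl⟩, hpar, h2⟩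
      rw [Nat.mul_div_mul_left _ _ two_pos] at hpar h2
      rw [Nat.mul_div_mul_left _ _ two_pos] at hpar
      replace hd := Nat.dvd_of_mul_dvd_mul_left two_pos hd
      replace hm := Nat.dvd_of_mul_dvd_mul_left two_pos hm
      refine ⟨d, m, ?_, rfl, rfl⟩
      by_cases h : 2 ∣ N / d
      · exact Or.inr ⟨⟨⟨hd, hN⟩, h⟩, fun h1 => h2 (by omega) h, ⟨hm, hN⟩, by omega⟩
      · exact Or.inl ⟨⟨⟨hd, hN⟩, h⟩, ⟨hm, hN⟩, by omega⟩
    · rintro ⟨a, b, h, rfl, rfl⟩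
      rw [Nat.mul_div_mul_left _ _ two_pos, Nat.mul_div_mul_left _ _ two_pos]
      have ha : a ∣ N := by tauto
      have hb : b ∣ N := by tauto
      refine ⟨mul_dvd_mul_left 2 ha, mul_dvd_mul_left 2 hb, by omega, dvd_mul_right 2 a,
        dvd_mul_right 2 b, ?_, fun hb2 h2 => ?_⟩
      · rcases h with h | h
        · have h1 := h.1.2
          have h2 := h.2.2
          omega
        · have h1 := h.1.2
          have h2 := h.2.2.2
          omega
      · rcases h with h | h
        · exact h.1.2 h2
        · exact h.2.1 (by omega)
  rw [this, Finset.card_image_of_injective, Finset.card_union_of_disjoint,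
    Finset.card_product, Finset.card_product, card_divisors_filter_not_even hq, sq]
  · congr 1
    have hEc : E.card = j * tauFun q := card_divisors_filter_even hq
    rcases Nat.eq_zero_or_pos j with h0 | hj
    · rw [hEc, h0, zero_mul, zero_mul, zero_mul]
    · rw [Finset.card_erase_of_mem, hEc]
      refine Finset.mem_filter.2 ⟨Nat.one_mem_divisors.2 hN, ?_⟩
      rw [Nat.div_one]
      exact (dvd_pow_self 2 hj.ne').mul_right q
  · rw [Finset.disjoint_left]
    intro x hx hx'
    exact hEO x.1 (Finset.mem_product.1 hx).1 (Finset.mem_product.1 hx').1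
  · exact (mul_right_injective₀ two_ne_zero).prodMap (mul_right_injective₀ two_ne_zero)

lemma card_validParam_two_pow_mul (hq : Odd q) :
    Nat.card {x // ValidParam (2 ^ (j + 1) * q) x} =
      betaFun (2 ^ (j + 1) * q) - tauFun (2 ^ (j + 1) * q) + tauFun (2 ^ j * q) ^ 2 -
        tauFun (2 ^ j * q) - j * tauFun q := by
  have hq0 := hq.pos.ne'
  have h2 : 2 ^ (j + 1) * q = 2 * (2 ^ j * q) := by ring
  have hN : 2 ^ j * q ≠ 0 := by positivity
  rw [card_validParam (by positivity), Fin.sum_univ_four, card_paramFinset_zero hq, h2,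
    card_paramFinset_sq hN (Or.inl rfl), card_paramFinset_sq hN (Or.inr rfl),
    card_paramFinset_three hq, ← h2, betaFun_two_pow_mul hq, tauFun_two_pow_mul hq,
    tauFun_two_pow_mul hq]
  obtain ⟨t, ht⟩ := Nat.exists_eq_add_of_lt (tauFun_pos hq)
  rw [zero_add] at ht
  rw [ht, add_tsub_cancel_right]
  obtain ⟨u, hu⟩ : ∃ u, j * (t + 1) * (j * (t + 1) - 1) = u ∧
      u + j * (t + 1) = (j * (t + 1)) ^ 2 := by
    refine ⟨_, rfl, ?_⟩
    rcases Nat.eq_zero_or_pos (j * (t + 1)) with h | h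
    · rw [h]
      rfl
    · obtain ⟨v, hv⟩ := Nat.exists_eq_add_of_lt h
      rw [hv]
      simp only [zero_add, add_tsub_cancel_right]
      ring
  rw [hu.1, show (j + 1) * (t + 1) - 1 = j * (t + 1) + t by ring_nf; omega]
  have hu2 := hu.2
  have hβ : (2 * j ^ 2 + 2 * j + 3) * (t + 1) ^ 2 - (j + 1 + 1) * (t + 1) =
      (2 * j ^ 2 + 2 * j + 3) * t * (t + 1) + (2 * j ^ 2 + j + 1) * (t + 1) := by
    apply Nat.sub_eq_of_eq_add
    ring
  rw [hβ]
  symm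
  apply Nat.sub_eq_of_eq_add
  apply Nat.sub_eq_of_eq_add
  nlinarith

end Arithmetic

/-- Let `ℓ` be an odd prime.  The number of conjugacy classes of subgroups of
`GL₂(ℤ/ℓℤ)` that are conjugate to a subgroup of `C_s⁺(ℓ)` and have dihedral projective
image equals `β(ℓ−1) − τ(ℓ−1) + τ((ℓ−1)/2)² − τ((ℓ−1)/2) − c`, where
`c = τ((ℓ−1)/4)` if `ℓ ≡ 1 (mod 4)` and `c = 0` if `ℓ ≡ 3 (mod 4)`. -/
theorem stmt10 (ℓ : ℕ) [Fact (Nat.Prime ℓ)] (hodd : Odd ℓ) :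
    conjClassCount (fun H : Subgroup (GL2 ℓ) =>
        (∃ c : GL2 ℓ, ∀ x ∈ H, IsCsPlusElt (c * x * c⁻¹)) ∧ IsDihedralProj H) =
      betaFun (ℓ - 1) - tauFun (ℓ - 1) + tauFun ((ℓ - 1) / 2) ^ 2 -
        tauFun ((ℓ - 1) / 2) -
        (if ℓ % 4 = 1 then tauFun ((ℓ - 1) / 4) else 0) := by
  have hn : ℓ - 1 ≠ 0 := (Nat.sub_pos_of_lt (Fact.out : ℓ.Prime).one_lt).ne'
  rw [conjClassCount_csPlus_dihedral hodd]
  obtain ⟨k, q, hq, hkq⟩ := Nat.exists_eq_two_pow_mul_odd hn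
  have hℓ := Nat.odd_iff.1 hodd
  obtain ⟨j, rfl⟩ : ∃ j, k = j + 1 := by
    refine Nat.exists_eq_succ_of_ne_zero ?_
    rintro rfl
    have := Nat.odd_iff.1 hq
    omega
  have h2 : 2 ^ (j + 1) * q = 2 * (2 ^ j * q) := by ring
  rw [hkq, card_validParam_two_pow_mul hq, show 2 ^ (j + 1) * q / 2 = 2 ^ j * q by omega]
  congr 1
  rcases j with _ | j
  · have := Nat.odd_iff.1 hq
    rw [zero_mul, if_neg (by omega)]
  · have h4 : 2 ^ (j + 1 + 1) * q = 4 * (2 ^ j * q) := by ring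
    rw [if_pos (by omega), ← tauFun_two_pow_mul hq,
      show 2 ^ (j + 1 + 1) * q / 4 = 2 ^ j * q by omega]
end
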